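/- Assume V is real-valued, θ₀, θ_R ∈ [0,2π), θ₀', θ_R' ∈ (0,2π)\{π}. Then for every z ∈ ℂ\[e₀,∞), the symmetrized Fredholm perturbation determinant reduces to a 2×2 determinant: det_{L²((0,R);dx)}(closure((H_{θ₀',θ_R'} − zI)^{1/2}(H_{θ₀,θ_R} − zI)^{-1}(H_{θ₀',θ_R'} − zI)^{1/2})) = [sin(θ₀)sin(θ_R)/(sin(θ₀')sin(θ_R'))] · det_{ℂ²}(Λ_{θ₀,θ_R}^{θ₀',θ_R'}(z)). -/

import Mathlib

open MeasureTheory Filter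
open scoped InnerProductSpace

noncomputable section
open scoped Classical


variable {H : Type*} [NormedAddCommGroup H] [InnerProductSpace ℂ H] [CompleteSpace H]

/-- `T` is the (bounded, everywhere defined) inverse of `A - z·I`. -/
def IsResolvent (A : H →ₗ.[ℂ] H) (z : ℂ) (T : H →L[ℂ] H) : Prop :=
  (∀ x : H, ∃ hx : T x ∈ A.domain, A ⟨T x, hx⟩ - z • T x = x) ∧
  ∀ u : A.domain, T (A u - z • (u : H)) = (u : H)

/-- The resolvent set of an unbounded operator. -/
def resolventSetP (A : H →ₗ.[ℂ] H) : Set ℂ := {z | ∃ T, IsResolvent A z T}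

/-- The spectrum of an unbounded operator. -/
def specP (A : H →ₗ.[ℂ] H) : Set ℂ := (resolventSetP A)ᶜ

/-- The resolvent `(A - z·I)⁻¹` (junk value `0` off the resolvent set). -/
def res (A : H →ₗ.[ℂ] H) (z : ℂ) : H →L[ℂ] H :=
  if h : ∃ T, IsResolvent A z T then h.choose else 0

/-- The operator `A + t·I` (same domain). -/
def shiftP (A : H →ₗ.[ℂ] H) (t : ℂ) : H →ₗ.[ℂ] H :=
  ⟨A.domain, A.toFun + t • A.domain.subtype⟩

/-- `A` is of positive type: `(-∞,0] ⊆ ρ(A)` and `sup_{t ≥ 0} ‖(1+t)(A+t)⁻¹‖ < ∞`. -/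
def IsPositiveTypeP (A : H →ₗ.[ℂ] H) : Prop :=
  (∀ x : ℝ, x ≤ 0 → (x : ℂ) ∈ resolventSetP A) ∧
  ∃ M : ℝ, ∀ t : ℝ, 0 ≤ t → (1 + t) * ‖res A (-(t : ℂ))‖ ≤ M

/-- The open sector of half-opening angle `ω` about the positive reals
(`(0,∞)` for `ω = 0`). -/
def sectorS (ω : ℝ) : Set ℂ :=
  if ω = 0 then (fun x : ℝ => (x : ℂ)) '' Set.Ioi 0
  else {z : ℂ | z ≠ 0 ∧ |Complex.arg z| < ω}

/-- `A` is sectorial of angle `ω`. -/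
def IsSectorialP (A : H →ₗ.[ℂ] H) (ω : ℝ) : Prop :=
  specP A ⊆ closure (sectorS ω) ∧
  ∀ ω' : ℝ, ω < ω' → ω' < Real.pi →
    ∃ M : ℝ, ∀ z ∈ (closure (sectorS ω'))ᶜ, ‖z‖ * ‖res A z‖ ≤ M

/-- The shifted sector `-t₀ + S_ω`. -/
def shiftedSector (t0 ω : ℝ) : Set ℂ := (fun w => -(t0 : ℂ) + w) '' sectorS ω

/-- The region `ℂ \ closure (-t₀ + S_ω)`. -/
def offSector (t0 ω : ℝ) : Set ℂ := (closure (shiftedSector t0 ω))ᶜ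

/-- The bounded operator `(A - z·I)^{-1/2}`, defined by the Balakrishnan-type formula
`(1/π) ∫₀^∞ t^{-1/2} (A + (t - z)·I)⁻¹ dt`. -/
def negSqrt (A : H →ₗ.[ℂ] H) (z : ℂ) : H →L[ℂ] H :=
  ((Real.pi : ℂ))⁻¹ • ∫ t in Set.Ioi (0 : ℝ), ((Real.sqrt t : ℂ))⁻¹ • res A (z - t)

/-- Trace-class (nuclear) bounded operators, characterized by
`sup { ∑ |⟨eᵢ, T fᵢ⟩| : (eᵢ), (fᵢ) finite orthonormal families } < ∞`. -/
def IsTraceClass (T : H →L[ℂ] H) : Prop :=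
  ∃ C : ℝ, ∀ (n : ℕ) (e f : Fin n → H), Orthonormal ℂ e → Orthonormal ℂ f →
    ∑ i, ‖⟪e i, T (f i)⟫_ℂ‖ ≤ C

/-- The trace norm `‖T‖₁`. -/
def traceNorm (T : H →L[ℂ] H) : ℝ :=
  sSup {s : ℝ | ∃ (n : ℕ) (e f : Fin n → H), Orthonormal ℂ e ∧ Orthonormal ℂ f ∧
    s = ∑ i, ‖⟪e i, T (f i)⟫_ℂ‖}

/-- The trace of a (trace-class) operator, computed in the Hilbert basis `b`. -/
def traceH (b : HilbertBasis ℕ ℂ H) (T : H →L[ℂ] H) : ℂ :=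
  ∑' n, ⟪(b n : H), T (b n)⟫_ℂ

/-- The Fredholm determinant `det (I + T)` (for `T` trace class), computed as the limit of
finite-section determinants along the Hilbert basis `b`. -/
def detI (b : HilbertBasis ℕ ℂ H) (T : H →L[ℂ] H) : ℂ :=
  limUnder atTop fun F : Finset ℕ =>
    Matrix.det (Matrix.of fun i j : F =>
      (if (i : ℕ) = (j : ℕ) then (1 : ℂ) else 0) + ⟪(b (i : ℕ) : H), T (b (j : ℕ))⟫_ℂ)


/-! ### One-dimensional Schrödinger operators on `[0,R]` -/

/-- The underlying Hilbert space `L²((0,R); dx)`. -/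
abbrev SchSp (Rr : ℝ) :=
  MeasureTheory.Lp ℂ 2 (MeasureTheory.volume.restrict (Set.Ioo (0 : ℝ) Rr))

/-- `u` (with derivative `du`) solves `-u'' + V u = z u` on `[0,R]`, with
`u, u' ∈ AC([0,R])` (the second derivative being encoded in integrated form). -/
def SolODE (Rr : ℝ) (V : ℝ → ℂ) (z : ℂ) (u du : ℝ → ℂ) : Prop :=
  (∀ x ∈ Set.Icc (0 : ℝ) Rr, HasDerivWithinAt u (du x) (Set.Icc (0 : ℝ) Rr) x) ∧
  ∀ x ∈ Set.Icc (0 : ℝ) Rr, du x = du 0 + ∫ t in (0 : ℝ)..x, (V t - z) * u t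

/-- The boundary trace `γ_{θ₀,θ_R}(u) = (cos θ₀ u(0) + sin θ₀ u'(0),
cos θ_R u(R) - sin θ_R u'(R))`. -/
def bdryC (Rr : ℝ) (t0 tR : ℂ) (u du : ℝ → ℂ) : Fin 2 → ℂ :=
  ![Complex.cos t0 * u 0 + Complex.sin t0 * du 0,
    Complex.cos tR * u Rr - Complex.sin tR * du Rr]

/-- `g` (with derivative `dg`) is an absolutely continuous representative of `f ∈ L²`
satisfying `-g'' + V g - z g = h` (in integrated form, with `h₀` a representative of
`h ∈ L²`); i.e. `f` represents `(H - z)⁻¹ h`. -/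
def SolvesAt (Rr : ℝ) (V : ℝ → ℂ) (z : ℂ) (f h : SchSp Rr) (g dg : ℝ → ℂ) : Prop :=
  (∀ᵐ x ∂(MeasureTheory.volume.restrict (Set.Ioo (0 : ℝ) Rr)), f x = g x) ∧
  (∀ x ∈ Set.Icc (0 : ℝ) Rr, HasDerivWithinAt g (dg x) (Set.Icc (0 : ℝ) Rr) x) ∧
  ∃ h0 : ℝ → ℂ,
    (∀ᵐ x ∂(MeasureTheory.volume.restrict (Set.Ioo (0 : ℝ) Rr)), h x = h0 x) ∧
    ∀ x ∈ Set.Icc (0 : ℝ) Rr,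
      dg x = dg 0 + ∫ t in (0 : ℝ)..x, (V t * g t - z * g t - h0 t)

/-- `Hop` is the Schrödinger operator `H_{θ₀,θ_R} = -d²/dx² + V` in `L²((0,R); dx)` with
separated boundary conditions `γ_{θ₀,θ_R}(g) = 0`, characterized through its graph. -/
def IsSchrodingerOp (Rr : ℝ) (V : ℝ → ℂ) (t0 tR : ℂ)
    (Hop : SchSp Rr →ₗ.[ℂ] SchSp Rr) : Prop :=
  ∀ f h : SchSp Rr, (f, h) ∈ Hop.graph ↔
    ∃ g dg : ℝ → ℂ, SolvesAt Rr V 0 f h g dg ∧ bdryC Rr t0 tR g dg = 0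

/-- `Λ` is the boundary data map `Λ_{θ₀,θ_R}^{θ₀',θ_R'}(z)`: for every solution `u` of
`-u'' + Vu = zu`, `Λ` maps `γ_{θ₀,θ_R}(u)` to `γ_{θ₀',θ_R'}(u)`. -/
def IsBoundaryDataMap (Rr : ℝ) (V : ℝ → ℂ) (t0 tR t0' tR' : ℂ) (z : ℂ)
    (Λ : Matrix (Fin 2) (Fin 2) ℂ) : Prop :=
  ∀ u du : ℝ → ℂ, SolODE Rr V z u du →
    Λ.mulVec (bdryC Rr t0 tR u du) = bdryC Rr t0' tR' u du

/-- `G` is the map `γ_{θ₀',θ_R'} ∘ (Hop - z)⁻¹ : L²((0,R)) → ℂ²`. -/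
def IsBdryResolventMap (Rr : ℝ) (V : ℝ → ℂ) (t0' tR' : ℂ) (z : ℂ)
    (Hop : SchSp Rr →ₗ.[ℂ] SchSp Rr)
    (G : SchSp Rr →L[ℂ] EuclideanSpace ℂ (Fin 2)) : Prop :=
  ∀ (h : SchSp Rr) (g dg : ℝ → ℂ), SolvesAt Rr V z (res Hop z h) h g dg →
    ∀ i : Fin 2, G h i = bdryC Rr t0' tR' g dg i

/-- The region `ℂ \ [c, ∞)`. -/
def offCut (c : ℝ) : Set ℂ := {z : ℂ | z.im ≠ 0 ∨ z.re < c}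

/-- `N` is the family `z ↦ (Hop - z)^{-1/2}`, defined via the spectral theorem with branch
cut along `[c, ∞)` (`c = inf σ(Hop)`): analytic on `ℂ \ [c,∞)`, squaring to the resolvent,
and positive (self-adjoint) for real `z < c`. -/
def IsSqrtResFam (Rr : ℝ) (Hop : SchSp Rr →ₗ.[ℂ] SchSp Rr) (c : ℝ)
    (N : ℂ → (SchSp Rr →L[ℂ] SchSp Rr)) : Prop :=
  (∀ z ∈ offCut c, (N z).comp (N z) = res Hop z) ∧
  (∀ x : ℝ, x < c →
    (∀ v w : SchSp Rr, ⟪N (x : ℂ) v, w⟫_ℂ = ⟪v, N (x : ℂ) w⟫_ℂ) ∧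
    ∀ v : SchSp Rr, 0 ≤ (⟪v, N (x : ℂ) v⟫_ℂ).re) ∧
  DifferentiableOn ℂ N (offCut c)

/-- The infimum `e₀ = inf(σ(Hop) ∪ σ(Hop'))`. -/
def einf (Rr : ℝ) (Hop Hop' : SchSp Rr →ₗ.[ℂ] SchSp Rr) : ℝ :=
  sInf {x : ℝ | (x : ℂ) ∈ specP Hop ∪ specP Hop'}

/-- The infimum of the spectrum of a single operator. -/
def einf1 (Rr : ℝ) (Hop : SchSp Rr →ₗ.[ℂ] SchSp Rr) : ℝ :=
  sInf {x : ℝ | (x : ℂ) ∈ specP Hop}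

open Topology in
theorem detI_eq_det_of_finite_rank (b : HilbertBasis ℕ ℂ H) (T : H →L[ℂ] H) {n : ℕ}
    (a c : Fin n → H) (hT : ∀ x, T x = ∑ i, ⟪c i, x⟫_ℂ • a i) :
    detI b T = Matrix.det (1 + Matrix.of fun i j => ⟪c i, a j⟫_ℂ) := by
  refine Tendsto.limUnder_eq ?_
  have key : ∀ F : Finset ℕ, Matrix.det (Matrix.of fun i j : F =>
      (if (i : ℕ) = (j : ℕ) then (1 : ℂ) else 0) + ⟪(b (i : ℕ) : H), T (b (j : ℕ))⟫_ℂ)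
      = Matrix.det (1 + Matrix.of fun i j => ∑ k ∈ F, ⟪c i, b k⟫_ℂ * ⟪b k, a j⟫_ℂ) := by
    intro F
    have h1 : (Matrix.of fun i j : F =>
        (if (i : ℕ) = (j : ℕ) then (1 : ℂ) else 0) + ⟪(b (i : ℕ) : H), T (b (j : ℕ))⟫_ℂ)
        = 1 + (Matrix.of fun (k : F) (i : Fin n) => ⟪b k, a i⟫_ℂ) *
          (Matrix.of fun (i : Fin n) (k : F) => ⟪c i, b k⟫_ℂ) := by
      ext i j
      simp only [Matrix.of_apply, Matrix.add_apply, Matrix.one_apply, Matrix.mul_apply, hT,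
        inner_sum, inner_smul_right, Subtype.ext_iff]
      congr 1
      exact Finset.sum_congr rfl fun _ _ => mul_comm _ _
    have h2 : (Matrix.of fun i j => ∑ k ∈ F, ⟪c i, b k⟫_ℂ * ⟪b k, a j⟫_ℂ)
        = (Matrix.of fun (i : Fin n) (k : F) => ⟪c i, b k⟫_ℂ) *
          (Matrix.of fun (k : F) (i : Fin n) => ⟪b k, a i⟫_ℂ) := by
      ext i j
      simp only [Matrix.of_apply, Matrix.mul_apply]
      exact (Finset.sum_coe_sort F fun k => ⟪c i, b k⟫_ℂ * ⟪b k, a j⟫_ℂ).symm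
    rw [h1, h2]
    convert Matrix.det_one_add_mul_comm _ _
  simp only [key]
  refine ((continuous_id.matrix_det).tendsto _).comp ?_
  refine Tendsto.const_add _ ?_
  refine tendsto_pi_nhds.2 fun i => tendsto_pi_nhds.2 fun j => ?_
  exact b.hasSum_inner_mul_inner (c i) (a j)

theorem res_isResolvent {A : H →ₗ.[ℂ] H} {z : ℂ} (hz : z ∈ resolventSetP A) :
    IsResolvent A z (res A z) := by
  have h : ∃ T, IsResolvent A z T := hz
  rw [res, dif_pos h]
  exact h.choose_spec

theorem res_apply_of_mem_graph {A : H →ₗ.[ℂ] H} {z : ℂ} (hz : z ∈ resolventSetP A) {f h : H}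
    (hf : (f, h + z • f) ∈ A.graph) : res A z h = f := by
  rw [LinearPMap.mem_graph_iff] at hf
  obtain ⟨y, hy1, hy2⟩ := hf
  have := (res_isResolvent hz).2 y
  simp only at hy1 hy2
  rw [hy2, hy1, add_sub_cancel_right] at this
  exact this

theorem res_mem_graph {A : H →ₗ.[ℂ] H} {z : ℂ} (hz : z ∈ resolventSetP A) (h : H) :
    (res A z h, h + z • res A z h) ∈ A.graph := by
  obtain ⟨hx, h2⟩ := (res_isResolvent hz).1 h
  rw [LinearPMap.mem_graph_iff]
  exact ⟨⟨_, hx⟩, rfl, by rw [← sub_eq_iff_eq_add.1 h2]⟩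

theorem res_injective {A : H →ₗ.[ℂ] H} {z : ℂ} (hz : z ∈ resolventSetP A) :
    Function.Injective (res A z) := by
  refine (injective_iff_map_eq_zero _).2 fun x hx => ?_
  have h := res_mem_graph hz x
  rw [hx, LinearPMap.mem_graph_iff] at h
  obtain ⟨y, hy1, hy2⟩ := h
  have : y = 0 := Subtype.ext hy1
  simpa [this] using hy2.symm

theorem domain_subset_range_res {A : H →ₗ.[ℂ] H} {z : ℂ} (hz : z ∈ resolventSetP A) :
    (A.domain : Set H) ⊆ Set.range (res A z) :=
  fun u hu => ⟨_, (res_isResolvent hz).2 ⟨u, hu⟩⟩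

/-- The first resolvent identity. -/
theorem res_sub_res {A : H →ₗ.[ℂ] H} {w z : ℂ} (hw : w ∈ resolventSetP A)
    (hz : z ∈ resolventSetP A) : res A w - res A z = (w - z) • (res A z * res A w) := by
  ext x
  have h := res_mem_graph hw x
  have : res A z (x + (w - z) • res A w x) = res A w x := by
    refine res_apply_of_mem_graph hz ?_
    convert h using 2
    module
  simp only [sub_apply, smul_apply, mul_apply_eq_comp]
  nth_rw 1 [← this]
  simp [map_add, map_smul]

theorem res_commute {A : H →ₗ.[ℂ] H} {w z : ℂ} (hw : w ∈ resolventSetP A)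
    (hz : z ∈ resolventSetP A) : Commute (res A w) (res A z) := by
  by_cases h : w = z
  · rw [h]
  have h1 := res_sub_res hw hz
  have h2 := res_sub_res hz hw
  have h3 : (w - z) • (res A z * res A w) = (w - z) • (res A w * res A z) := by
    rw [← h1, ← neg_sub, h2, ← neg_smul, neg_sub]
  exact (smul_right_injective _ (sub_ne_zero.2 h) h3).symm

/-- An operator commuting with one resolvent commutes with every resolvent. -/
theorem commute_res_of_commute_res {A : H →ₗ.[ℂ] H} {w z : ℂ} (hw : w ∈ resolventSetP A)
    (hz : z ∈ resolventSetP A) {B : H →L[ℂ] H} (hB : Commute B (res A z)) :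
    Commute B (res A w) := by
  have h1 := res_sub_res hw hz
  have hc := res_commute hw hz
  have hBZ : Commute B (1 + (z - w) • res A z) :=
    (Commute.one_right B).add_right (hB.smul_right _)
  have e1 : res A w * (1 + (z - w) • res A z) = res A z := by
    rw [mul_add, mul_one, mul_smul_comm (z - w) (res A w) (res A z), hc.eq, ← sub_eq_zero,
      ← sub_eq_zero.2 h1]
    module
  have e2 : (1 + (z - w) • res A z) * (1 + (w - z) • res A w) = 1 := by
    have e20 : (1 + (z - w) • res A z) * (1 + (w - z) • res A w)
        = 1 + (w - z) • (res A w - res A z - (w - z) • (res A z * res A w)) := by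
      simp only [mul_add, add_mul, one_mul, mul_one, smul_mul_assoc, mul_smul_comm]
      module
    rw [e20, h1]; simp
  have e3 : (1 + (w - z) • res A w) * (1 + (z - w) • res A z) = 1 := by
    refine Eq.trans ?_ e2
    simp only [mul_add, add_mul, one_mul, mul_one, smul_mul_assoc, mul_smul_comm, hc.eq]
    module
  let Z : (H →L[ℂ] H)ˣ := ⟨1 + (z - w) • res A z, 1 + (w - z) • res A w, e2, e3⟩
  have hBY : Commute B (↑Z⁻¹ : H →L[ℂ] H) := Commute.units_inv_right hBZ
  have e4 : res A w = res A z * (↑Z⁻¹ : H →L[ℂ] H) := by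
    rw [Units.eq_mul_inv_iff_mul_eq]; exact e1
  rw [e4]
  exact hB.mul_right hBY

theorem formal_symm {A : H →ₗ.[ℂ] H} (hA : IsSelfAdjoint A) (u v : A.domain) :
    ⟪A u, (v : H)⟫_ℂ = ⟪(u : H), A v⟫_ℂ := by
  have h := LinearPMap.adjoint_isFormalAdjoint hA.dense_domain
  rw [LinearPMap.isSelfAdjoint_def.1 hA] at h
  exact h u v

theorem mem_resolventSetP_of_lower_bound {A : H →ₗ.[ℂ] H} (hA : IsSelfAdjoint A) {w : ℂ}
    {c : ℝ} (hc : 0 < c) (h1 : ∀ u : A.domain, c * ‖(u : H)‖ ≤ ‖A u - w • (u : H)‖)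
    (h2 : ∀ u : A.domain, c * ‖(u : H)‖ ≤ ‖A u - (starRingEnd ℂ w) • (u : H)‖) :
    w ∈ resolventSetP A := by
  have hcl : IsClosed (A.graph : Set (H × H)) := hA.isClosed
  have : CompleteSpace A.graph := hcl.completeSpace_coe
  let Φ : A.graph →L[ℂ] H :=
    (ContinuousLinearMap.snd ℂ H H - w • ContinuousLinearMap.fst ℂ H H).comp A.graph.subtypeL
  have hΦ : ∀ p : A.graph, Φ p = p.1.2 - w • p.1.1 := fun p => rfl
  have hlow : ∀ p : A.graph, c * ‖p.1.1‖ ≤ ‖Φ p‖ := by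
    intro p
    obtain ⟨y, hy1, hy2⟩ := (LinearPMap.mem_graph_iff _).1 p.2
    have := h1 y
    rwa [hy1, hy2] at this
  have hanti : AntilipschitzWith (Real.toNNReal (c⁻¹ + (1 + ‖w‖ * c⁻¹))) Φ := by
    refine AddMonoidHomClass.antilipschitz_of_bound _ fun p => ?_
    rw [Real.coe_toNNReal _ (by positivity)]
    have e1 : ‖p.1.1‖ ≤ c⁻¹ * ‖Φ p‖ := by
      rw [inv_mul_eq_div, le_div_iff₀ hc, mul_comm]; exact hlow p
    have e2 : ‖p.1.2‖ ≤ ‖Φ p‖ + ‖w‖ * ‖p.1.1‖ := by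
      rw [← norm_smul]
      have : p.1.2 = Φ p + w • p.1.1 := by rw [hΦ]; abel
      nth_rw 1 [this]
      exact norm_add_le _ _
    have e3 : ‖w‖ * ‖p.1.1‖ ≤ ‖w‖ * (c⁻¹ * ‖Φ p‖) := by gcongr
    have e4 : 0 ≤ ‖w‖ * (c⁻¹ * ‖Φ p‖) := by positivity
    have e5 : 0 ≤ c⁻¹ * ‖Φ p‖ := by positivity
    have : ‖p‖ = max ‖p.1.1‖ ‖p.1.2‖ := rfl
    rw [this]
    refine max_le ?_ ?_
    · nlinarith [norm_nonneg (Φ p)]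
    · nlinarith [norm_nonneg (Φ p)]
  have hrc : IsClosed (Set.range Φ) := hanti.isClosed_range Φ.uniformContinuous
  have horth : (LinearMap.range (Φ : A.graph →ₗ[ℂ] H))ᗮ = ⊥ := by
    rw [Submodule.eq_bot_iff]
    intro y hy
    rw [Submodule.mem_orthogonal'] at hy
    have hyA : ∀ u : A.domain, ⟪(starRingEnd ℂ w) • y, (u : H)⟫_ℂ = ⟪y, A u⟫_ℂ := by
      intro u
      have := hy (Φ ⟨(u, A u), LinearPMap.mem_graph A u⟩) ⟨_, rfl⟩
      rw [hΦ] at this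
      simp only [inner_sub_right, inner_smul_right] at this
      rw [inner_smul_left, Complex.conj_conj]
      linear_combination -this
    have hd := LinearPMap.mem_adjoint_domain_of_exists (T := A) y ⟨_, hyA⟩
    have hv := LinearPMap.adjoint_apply_eq hA.dense_domain ⟨y, hd⟩ hyA
    have hmem : (y, (starRingEnd ℂ w) • y) ∈ A.graph := by
      rw [← LinearPMap.isSelfAdjoint_def.1 hA, LinearPMap.mem_graph_iff]
      exact ⟨⟨y, hd⟩, rfl, hv⟩
    obtain ⟨v, hv1, hv2⟩ := (LinearPMap.mem_graph_iff _).1 hmem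
    have := h2 v
    simp only at hv1 hv2
    rw [hv2, hv1, sub_self, norm_zero] at this
    have hn : ‖y‖ ≤ 0 := by
      by_contra hcon
      push Not at hcon
      have := mul_pos hc hcon
      linarith
    simpa using hn
  have hrange : LinearMap.range (Φ : A.graph →ₗ[ℂ] H) = ⊤ := by
    have : IsClosed ((LinearMap.range (Φ : A.graph →ₗ[ℂ] H) : Submodule ℂ H) : Set H) := hrc
    have := this.completeSpace_coe
    exact (Submodule.orthogonal_eq_bot_iff).1 horth
  have hker : LinearMap.ker (Φ : A.graph →ₗ[ℂ] H) = ⊥ :=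
    LinearMap.ker_eq_bot.2 hanti.injective
  let E := ContinuousLinearEquiv.ofBijective Φ hker hrange
  refine ⟨((ContinuousLinearMap.fst ℂ H H).comp A.graph.subtypeL).comp
    (E.symm : H →L[ℂ] A.graph), ?_, ?_⟩
  · intro x
    obtain ⟨y, hy1, hy2⟩ := (LinearPMap.mem_graph_iff _).1 (E.symm x).2
    have hx : Φ (E.symm x) = x := ContinuousLinearEquiv.ofBijective_apply_symm_apply Φ hker hrange x
    rw [hΦ] at hx
    have hy3 : (E.symm x).1.1 ∈ A.domain := hy1 ▸ y.2
    refine ⟨hy3, ?_⟩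
    have : (⟨(E.symm x).1.1, hy3⟩ : A.domain) = y := Subtype.ext hy1.symm
    change A ⟨(E.symm x).1.1, hy3⟩ - w • (E.symm x).1.1 = x
    rw [this, hy2, hx]
  · intro u
    have : E.symm (Φ ⟨(u, A u), LinearPMap.mem_graph A u⟩) = ⟨(u, A u), LinearPMap.mem_graph A u⟩ :=
      ContinuousLinearEquiv.ofBijective_symm_apply_apply Φ hker hrange _
    rw [hΦ] at this
    change (E.symm (A u - w • (u : H))).1.1 = u
    rw [this]

theorem inner_self_eq_ofReal (u : H) : ⟪u, u⟫_ℂ = ((‖u‖ ^ 2 : ℝ) : ℂ) := by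
  rw [inner_self_eq_norm_sq_to_K]
  push_cast
  rfl

theorem im_mul_norm_le {A : H →ₗ.[ℂ] H} (hA : IsSelfAdjoint A) (w : ℂ) (u : A.domain) :
    |w.im| * ‖(u : H)‖ ≤ ‖A u - w • (u : H)‖ := by
  have hreal : (⟪(u : H), A u⟫_ℂ).im = 0 := by
    have h := formal_symm hA u u
    have h2 := inner_conj_symm (𝕜 := ℂ) (u : H) (A u)
    rw [h] at h2
    exact Complex.conj_eq_iff_im.1 h2
  have e : (⟪(u : H), A u - w • (u : H)⟫_ℂ).im = -(w.im * ‖(u : H)‖ ^ 2) := by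
    rw [inner_sub_right, inner_smul_right, inner_self_eq_ofReal, Complex.sub_im, hreal,
      Complex.mul_im, Complex.ofReal_re, Complex.ofReal_im]
    simp
  have h1 : |w.im| * ‖(u : H)‖ ^ 2 ≤ ‖(u : H)‖ * ‖A u - w • (u : H)‖ := by
    calc |w.im| * ‖(u : H)‖ ^ 2 = |(⟪(u : H), A u - w • (u : H)⟫_ℂ).im| := by
          rw [e, abs_neg, abs_mul, abs_of_nonneg (sq_nonneg ‖(u : H)‖)]
      _ ≤ ‖⟪(u : H), A u - w • (u : H)⟫_ℂ‖ := Complex.abs_im_le_norm _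
      _ ≤ _ := norm_inner_le_norm _ _
  rcases (norm_nonneg (u : H)).eq_or_lt with h0 | h0
  · rw [← h0]; simp
  · refine le_of_mul_le_mul_left ?_ h0
    calc ‖(u : H)‖ * (|w.im| * ‖(u : H)‖) = |w.im| * ‖(u : H)‖ ^ 2 := by ring
      _ ≤ _ := h1

theorem mem_resolventSetP_of_im_ne_zero {A : H →ₗ.[ℂ] H} (hA : IsSelfAdjoint A) {w : ℂ}
    (hw : w.im ≠ 0) : w ∈ resolventSetP A := by
  refine mem_resolventSetP_of_lower_bound hA (abs_pos.2 hw) (im_mul_norm_le hA w) fun u => ?_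
  have := im_mul_norm_le hA (starRingEnd ℂ w) u
  rwa [Complex.conj_im, abs_neg] at this

theorem im_mul_norm_res_le {A : H →ₗ.[ℂ] H} (hA : IsSelfAdjoint A) {w : ℂ}
    (hw : w.im ≠ 0) (x : H) : |w.im| * ‖res A w x‖ ≤ ‖x‖ := by
  obtain ⟨hx, h2⟩ := (res_isResolvent (mem_resolventSetP_of_im_ne_zero hA hw)).1 x
  have := im_mul_norm_le hA w ⟨_, hx⟩
  rwa [h2] at this

theorem mem_resolventSetP_of_semibounded {A : H →ₗ.[ℂ] H} (hA : IsSelfAdjoint A) {C x : ℝ}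
    (hC : ∀ u : A.domain, -C * ‖(u : H)‖ ^ 2 ≤ (⟪(u : H), A u⟫_ℂ).re) (hx : x < -C) :
    (x : ℂ) ∈ resolventSetP A := by
  have key : ∀ u : A.domain, (-C - x) * ‖(u : H)‖ ≤ ‖A u - (x : ℂ) • (u : H)‖ := by
    intro u
    have e : (⟪(u : H), A u - (x : ℂ) • (u : H)⟫_ℂ).re
        = (⟪(u : H), A u⟫_ℂ).re - x * ‖(u : H)‖ ^ 2 := by
      rw [inner_sub_right, inner_smul_right, inner_self_eq_ofReal, Complex.sub_re,
        Complex.re_ofReal_mul, Complex.ofReal_re]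
    have h1 : (-C - x) * ‖(u : H)‖ ^ 2 ≤ ‖(u : H)‖ * ‖A u - (x : ℂ) • (u : H)‖ := by
      calc (-C - x) * ‖(u : H)‖ ^ 2 ≤ (⟪(u : H), A u - (x : ℂ) • (u : H)⟫_ℂ).re := by
            rw [e]; linarith [hC u]
        _ ≤ ‖⟪(u : H), A u - (x : ℂ) • (u : H)⟫_ℂ‖ := Complex.re_le_norm _
        _ ≤ _ := norm_inner_le_norm _ _
    rcases (norm_nonneg (u : H)).eq_or_lt with h0 | h0
    · rw [← h0]; simp
    · refine le_of_mul_le_mul_left ?_ h0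
      calc ‖(u : H)‖ * ((-C - x) * ‖(u : H)‖) = (-C - x) * ‖(u : H)‖ ^ 2 := by ring
        _ ≤ _ := h1
  refine mem_resolventSetP_of_lower_bound hA (c := -C - x) (by linarith) key ?_
  simpa using key

theorem exists_real_mem_specP [Nontrivial H] {A : H →ₗ.[ℂ] H} (hA : IsSelfAdjoint A) :
    ∃ x : ℝ, (x : ℂ) ∈ specP A := by
  by_contra hcon
  push Not at hcon
  have hall : ∀ w : ℂ, w ∈ resolventSetP A := by
    intro w
    by_cases hw : w.im = 0
    · have h := hcon w.re
      rw [show ((w.re : ℝ) : ℂ) = w from Complex.ext rfl (by simp [hw])] at h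
      simpa [specP] using h
    · exact mem_resolventSetP_of_im_ne_zero hA hw
  set T := res A 0
  have hT : IsSelfAdjoint T := by
    rw [ContinuousLinearMap.isSelfAdjoint_iff_isSymmetric]
    intro x y
    obtain ⟨hx, ex⟩ := (res_isResolvent (hall 0)).1 x
    obtain ⟨hy, ey⟩ := (res_isResolvent (hall 0)).1 y
    rw [zero_smul, sub_zero] at ex ey
    have := formal_symm hA ⟨_, hx⟩ ⟨_, hy⟩
    rw [ex, ey] at this
    exact this.symm
  have hspec : spectrum ℂ T ⊆ {0} := by
    intro μ hμ
    by_contra h0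
    have h0 : μ ≠ 0 := h0
    refine hμ ?_
    have h1 := res_sub_res (hall μ⁻¹) (hall 0)
    have hc := res_commute (hall μ⁻¹) (hall 0)
    rw [sub_zero] at h1
    set S := res A μ⁻¹
    have hST : S * T = T * S := hc
    have h3 : T * S = μ • (S - T) := by rw [h1, smul_smul, mul_inv_cancel₀ h0, one_smul]
    have e1 : μ • (μ⁻¹ • (1 + μ⁻¹ • S)) = 1 + μ⁻¹ • S := by
      rw [smul_smul, mul_inv_cancel₀ h0, one_smul]
    have e4 : T + μ⁻¹ • (μ • (S - T)) = S := by
      rw [smul_smul, inv_mul_cancel₀ h0, one_smul, add_sub_cancel]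
    have e2 : (algebraMap ℂ (H →L[ℂ] H) μ - T) * (μ⁻¹ • (1 + μ⁻¹ • S)) = 1 := by
      rw [Algebra.algebraMap_eq_smul_one, sub_mul, smul_mul_assoc, one_mul, e1, mul_smul_comm,
        mul_add, mul_one, mul_smul_comm, h3, e4, add_sub_cancel_right]
    have e3 : (μ⁻¹ • (1 + μ⁻¹ • S)) * (algebraMap ℂ (H →L[ℂ] H) μ - T) = 1 := by
      rw [Algebra.algebraMap_eq_smul_one, mul_sub, mul_smul_comm, mul_one, e1, smul_mul_assoc,
        add_mul, one_mul, smul_mul_assoc, hST, h3, e4, add_sub_cancel_right]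
    exact ⟨⟨_, _, e2, e3⟩, rfl⟩
  have hnorm := hT.spectralRadius_eq_nnnorm
  have hz : spectralRadius ℂ T = 0 := by
    refine le_antisymm ?_ bot_le
    refine iSup₂_le fun μ hμ => ?_
    rw [hspec hμ]; simp
  rw [hz] at hnorm
  have hT0 : T = 0 := by simpa using hnorm.symm
  obtain ⟨x, hx⟩ := exists_ne (0 : H)
  refine hx (res_injective (hall 0) ?_)
  change T x = T 0
  simp [hT0]

/-- `-w (A - w)⁻¹ → 1` strongly as `w → ∞` along the imaginary axis. -/
theorem tendsto_neg_smul_res {A : H →ₗ.[ℂ] H} (hA : IsSelfAdjoint A) {t : ℕ → ℝ}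
    (ht : ∀ n, 0 < t n) (htt : Tendsto t atTop atTop) (x : H) :
    Tendsto (fun n => -(Complex.I * t n) • res A (Complex.I * t n) x) atTop (nhds x) := by
  have him : ∀ n, (Complex.I * t n).im = t n := fun n => by simp
  have hne : ∀ n, (Complex.I * t n).im ≠ 0 := fun n => by rw [him]; exact (ht n).ne'
  have hb : ∀ n y, t n * ‖res A (Complex.I * t n) y‖ ≤ ‖y‖ := by
    intro n y
    have := im_mul_norm_res_le hA (hne n) y
    rwa [him, abs_of_pos (ht n)] at this
  have hb2 : ∀ n y, ‖-(Complex.I * t n) • res A (Complex.I * t n) y‖ ≤ ‖y‖ := by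
    intro n y
    rw [norm_smul]
    simpa [abs_of_pos (ht n)] using hb n y
  rw [Metric.tendsto_atTop]
  intro ε hε
  obtain ⟨u, hu, hux⟩ := Metric.dense_iff.1 hA.dense_domain x (ε / 3) (by positivity)
  rw [Metric.mem_ball, dist_eq_norm] at hu
  obtain ⟨N, hN⟩ := (htt.eventually_gt_atTop (‖A ⟨u, hux⟩‖ / (ε / 3))).exists_forall_of_atTop
  refine ⟨N, fun n hn => ?_⟩
  have h1 : res A (Complex.I * t n) (A ⟨u, hux⟩) - (Complex.I * t n) • res A (Complex.I * t n) u
      = u := by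
    have := (res_isResolvent (mem_resolventSetP_of_im_ne_zero hA (hne n))).2 ⟨u, hux⟩
    simpa [map_sub, map_smul] using this
  have h2 : -(Complex.I * t n) • res A (Complex.I * t n) u - u
      = - res A (Complex.I * t n) (A ⟨u, hux⟩) := by
    nth_rw 2 [← h1]; module
  have h3 : ‖res A (Complex.I * t n) (A ⟨u, hux⟩)‖ < ε / 3 := by
    have ha := hb n (A ⟨u, hux⟩)
    have hc := hN n hn
    rw [div_lt_iff₀ (by positivity)] at hc
    have : t n * ‖res A (Complex.I * t n) (A ⟨u, hux⟩)‖ < t n * (ε / 3) := by linarith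
    exact lt_of_mul_lt_mul_left this (ht n).le
  rw [dist_eq_norm]
  have e : -(Complex.I * t n) • res A (Complex.I * t n) x - x
      = -(Complex.I * t n) • res A (Complex.I * t n) (x - u)
        + (-(Complex.I * t n) • res A (Complex.I * t n) u - u) + (u - x) := by
    rw [map_sub, smul_sub]; abel
  rw [e, h2]
  refine (norm_add₃_le).trans_lt ?_
  have h4 := hb2 n (x - u)
  rw [norm_neg]
  rw [norm_sub_rev] at h4
  linarith

/-- If `N` is injective with dense range and `N T N` has range in the span of `χ₀, χ₁`, the
Fredholm determinant of `1 + T` is the limit of the `2 × 2` determinants describing the action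
of `N T N` along a regularization `N Yₙ N → 1` (strongly). -/
theorem detI_eq_det_of_tendsto (b : HilbertBasis ℕ ℂ H) (N T : H →L[ℂ] H)
    (hinj : Function.Injective N) (hdense : Dense (Set.range N)) (χ : Fin 2 → H)
    (hχ : LinearIndependent ℂ χ)
    (hspan : ∀ x, N (T (N x)) ∈ Submodule.span ℂ (Set.range χ))
    (Y : ℕ → H →L[ℂ] H)
    (hY : ∀ x, Tendsto (fun n => N (Y n (N x))) atTop (nhds x))
    (K : ℕ → Matrix (Fin 2) (Fin 2) ℂ) (K' : Matrix (Fin 2) (Fin 2) ℂ)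
    (hK : ∀ n l, N (T (N (Y n (χ l)))) = ∑ k, K n k l • χ k)
    (hlim : Tendsto K atTop (nhds K')) :
    detI b T = (1 + K').det := by
  set S := Submodule.span ℂ (Set.range χ)
  have : FiniteDimensional ℂ S := FiniteDimensional.span_of_finite ℂ (Set.finite_range χ)
  have hS : ∀ x, N (T x) ∈ S := by
    have hcl : IsClosed {x | N (T x) ∈ S} :=
      (Submodule.closed_of_finiteDimensional S).preimage (N.continuous.comp T.continuous)
    intro x
    have hsub : Set.range N ⊆ {x | N (T x) ∈ S} := by rintro _ ⟨y, rfl⟩; exact hspan y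
    exact hcl.closure_subset_iff.2 hsub (hdense x)
  have : FiniteDimensional ℂ (LinearMap.range (T : H →ₗ[ℂ] H)) := by
    let g : LinearMap.range (T : H →ₗ[ℂ] H) →ₗ[ℂ] S :=
      LinearMap.codRestrict S ((N : H →ₗ[ℂ] H).comp (Submodule.subtype _))
        (by rintro ⟨_, x, rfl⟩; exact hS x)
    refine FiniteDimensional.of_injective g fun p q hpq => Subtype.ext (hinj ?_)
    exact congrArg Subtype.val hpq
  let e := stdOrthonormalBasis ℂ (LinearMap.range (T : H →ₗ[ℂ] H))
  let a : Fin (Module.finrank ℂ (LinearMap.range (T : H →ₗ[ℂ] H))) → H := fun i => (e i : H)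
  let c : Fin (Module.finrank ℂ (LinearMap.range (T : H →ₗ[ℂ] H))) → H :=
    fun i => ContinuousLinearMap.adjoint T (a i)
  have hT : ∀ x, T x = ∑ i, ⟪c i, x⟫_ℂ • a i := by
    intro x
    have h := e.sum_repr' ⟨T x, x, rfl⟩
    have h2 := congrArg Subtype.val h
    simp only [Submodule.coe_sum, Submodule.coe_smul, Submodule.coe_inner] at h2
    rw [← h2]
    refine Finset.sum_congr rfl fun i _ => ?_
    rw [ContinuousLinearMap.adjoint_inner_left]
  rw [detI_eq_det_of_finite_rank b T a c hT]
  have haS : ∀ j, N (a j) ∈ S := by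
    intro j
    obtain ⟨x, hx⟩ := (e j).2
    have := hS x
    rwa [show T x = a j from hx] at this
  choose C hC using fun j => (Submodule.mem_span_range_iff_exists_fun ℂ).1 (haS j)
  have hn : ∀ n, Matrix.det (1 + Matrix.of fun i j => ⟪c i, N (Y n (N (a j)))⟫_ℂ)
      = (1 + K n).det := by
    intro n
    have e1 : (Matrix.of fun i j => ⟪c i, N (Y n (N (a j)))⟫_ℂ)
        = (Matrix.of fun i (k : Fin 2) => ⟪c i, N (Y n (χ k))⟫_ℂ) *
          (Matrix.of fun (k : Fin 2) j => C j k) := by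
      ext i j
      simp only [Matrix.of_apply, Matrix.mul_apply]
      rw [← hC j]
      simp only [map_sum, map_smul, inner_sum, inner_smul_right]
      exact Finset.sum_congr rfl fun _ _ => mul_comm _ _
    have e2 : (Matrix.of fun (k : Fin 2) j => C j k) *
        (Matrix.of fun i (k : Fin 2) => ⟪c i, N (Y n (χ k))⟫_ℂ) = K n := by
      ext k l
      have h1 := hK n l
      rw [hT, map_sum] at h1
      simp only [map_smul, ← hC, Finset.smul_sum, smul_smul] at h1
      rw [Finset.sum_comm] at h1
      simp only [← Finset.sum_smul] at h1
      have h2 := Fintype.linearIndependent_iff.1 hχ (fun k => ∑ i, ⟪c i, N (Y n (χ l))⟫_ℂ * C i k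
        - K n k l) (by simp only [sub_smul, Finset.sum_sub_distrib]; rw [h1, sub_self]) k
      simp only [Matrix.mul_apply, Matrix.of_apply]
      rw [← sub_eq_zero, ← h2]
      congr 1
      exact Finset.sum_congr rfl fun _ _ => mul_comm _ _
    rw [e1, Matrix.det_one_add_mul_comm, e2]
  have l1 : Tendsto (fun n => Matrix.det (1 + Matrix.of fun i j => ⟪c i, N (Y n (N (a j)))⟫_ℂ))
      atTop (nhds (Matrix.det (1 + Matrix.of fun i j => ⟪c i, a j⟫_ℂ))) := by
    refine ((continuous_id.matrix_det).tendsto _).comp ?_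
    refine Tendsto.const_add _ ?_
    refine tendsto_pi_nhds.2 fun i => tendsto_pi_nhds.2 fun j => ?_
    exact tendsto_const_nhds.inner (hY (a j))
  simp only [hn] at l1
  exact tendsto_nhds_unique l1
    (((continuous_id.matrix_det).tendsto _).comp (hlim.const_add 1))

theorem integral_norm_mul_exp_le {q : ℝ → ℂ} (hq : Integrable q) {k x : ℝ} (hk : 0 < k)
    (hx : 0 ≤ x) :
    ∫ t in (0 : ℝ)..x, ‖q t‖ * Real.exp (k * ∫ s in (0 : ℝ)..t, ‖q s‖)
      ≤ Real.exp (k * ∫ s in (0 : ℝ)..x, ‖q s‖) / k := by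
  set Q : ℝ → ℝ := fun t => ∫ s in (0 : ℝ)..t, ‖q s‖ with hQ
  have hi : ∀ a b, IntervalIntegrable (fun s => ‖q s‖) volume a b :=
    fun a b => hq.norm.intervalIntegrable
  have hmono : Monotone Q := by
    intro s t hst
    have : Q t - Q s = ∫ r in s..t, ‖q r‖ := intervalIntegral.integral_interval_sub_left (hi _ _) (hi _ _)
    have h2 : 0 ≤ ∫ r in s..t, ‖q r‖ := intervalIntegral.integral_nonneg hst fun _ _ => norm_nonneg _
    linarith
  have hmono2 : Monotone fun t => Real.exp (k * Q t) := fun s t hst =>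
    Real.exp_le_exp.2 (mul_le_mul_of_nonneg_left (hmono hst) hk.le)
  have h1 := (hmono2.monotoneOn (Set.uIcc 0 x)).intervalIntegral_deriv_mem_uIcc
  have h2 : ∫ t in (0 : ℝ)..x, deriv (fun t => Real.exp (k * Q t)) t
      = ∫ t in (0 : ℝ)..x, k * (‖q t‖ * Real.exp (k * Q t)) := by
    refine intervalIntegral.integral_congr_ae ?_
    filter_upwards [(hi 0 x).ae_hasDerivAt_integral] with t ht htx
    have := ht (Set.uIoc_subset_uIcc htx) 0 Set.left_mem_uIcc
    rw [((this.const_mul k).exp).deriv]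
    ring
  rw [h2, intervalIntegral.integral_const_mul, Set.uIcc_of_le
    (sub_nonneg.2 (hmono2 hx))] at h1
  rw [le_div_iff₀ hk, mul_comm]
  refine h1.2.trans ?_
  have := Real.exp_pos (k * Q 0)
  linarith

/-- Existence for the initial value problem `u'' = q u` with integrable `q`. -/
theorem exists_ivp_solution {R : ℝ} (hR : 0 < R) {q : ℝ → ℂ} (hq : Integrable q) (a b : ℂ) :
    ∃ u du : ℝ → ℂ, (∀ x, HasDerivAt u (du x) x) ∧
      (∀ x ∈ Set.Icc 0 R, du x = b + ∫ t in (0 : ℝ)..x, q t * u t) ∧ u 0 = a ∧ du 0 = b := by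
  set Q : ℝ → ℝ := fun t => ∫ s in (0 : ℝ)..t, ‖q s‖ with hQ
  have hQc : Continuous Q :=
    intervalIntegral.continuous_primitive (fun a b => hq.norm.intervalIntegrable) 0
  set k : ℝ := 2 * R with hk
  have hk0 : 0 < k := by positivity
  set E : ℝ → ℝ := fun t => Real.exp (k * Q t) with hE
  have hEc : Continuous E := by fun_prop
  let X := C(Set.Icc (0 : ℝ) R, ℂ)
  let ext : X → ℝ → ℂ := fun w => Set.IccExtend hR.le w
  have hext : ∀ w : X, Continuous (ext w) := fun w => w.continuous.Icc_extend'
  have hbd : ∀ (w : X) t, ‖ext w t‖ ≤ ‖w‖ := fun w t => w.norm_coe_le_norm _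
  have hsub : ∀ (w w' : X) t, ext w t - ext w' t = ext (w - w') t := fun w w' t => rfl
  have hint : ∀ (w : X) s t,
      IntervalIntegrable (fun t => q t * ((E t : ℂ) * ext w t)) volume s t := fun w s t =>
    hq.intervalIntegrable.mul_continuousOn
      ((Complex.continuous_ofReal.comp hEc).mul (hext w)).continuousOn
  let dv : X → ℝ → ℂ := fun w s => b + ∫ t in (0 : ℝ)..s, q t * ((E t : ℂ) * ext w t)
  have hdv : ∀ w, Continuous (dv w) := fun w =>
    continuous_const.add (intervalIntegral.continuous_primitive (hint w) 0)
  let v : X → ℝ → ℂ := fun w x => a + ∫ s in (0 : ℝ)..x, dv w s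
  have hv : ∀ w x, HasDerivAt (v w) (dv w x) x := fun w x =>
    ((hdv w).integral_hasStrictDerivAt 0 x).hasDerivAt.const_add a
  have hvc : ∀ w, Continuous (v w) := fun w =>
    continuous_iff_continuousAt.2 fun x => (hv w x).continuousAt
  let Ψ : X → X := fun w => ⟨fun x => ((E x)⁻¹ : ℝ) * v w x, by
    have : Continuous fun x => (((E x)⁻¹ : ℝ) : ℂ) * v w x :=
      (Complex.continuous_ofReal.comp
        (hEc.inv₀ fun x => (Real.exp_pos _).ne')).mul (hvc w)
    exact this.comp continuous_subtype_val⟩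
  have hdiff : ∀ w w' : X, ∀ s ∈ Set.Icc 0 R, ‖dv w s - dv w' s‖ ≤ ‖w - w'‖ * (E s / k) := by
    intro w w' s hs
    have e : dv w s - dv w' s = ∫ t in (0 : ℝ)..s, q t * ((E t : ℂ) * ext (w - w') t) := by
      simp only [dv, add_sub_add_left_eq_sub]
      rw [← intervalIntegral.integral_sub (hint w _ _) (hint w' _ _)]
      refine intervalIntegral.integral_congr fun t _ => ?_
      simp only [← hsub]; ring
    rw [e]
    calc ‖∫ t in (0 : ℝ)..s, q t * ((E t : ℂ) * ext (w - w') t)‖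
        ≤ ∫ t in (0 : ℝ)..s, ‖w - w'‖ * (‖q t‖ * E t) := by
          refine intervalIntegral.norm_integral_le_of_norm_le hs.1 (ae_of_all _ fun t _ => ?_)
            ((hq.norm.intervalIntegrable.mul_continuousOn hEc.continuousOn).const_mul _)
          rw [norm_mul, norm_mul, Complex.norm_real, Real.norm_of_nonneg (Real.exp_pos _).le]
          have := mul_le_mul_of_nonneg_left (hbd (w - w') t)
            (mul_nonneg (norm_nonneg (q t)) (Real.exp_pos (k * Q t)).le)
          calc ‖q t‖ * (E t * ‖ext (w - w') t‖) = ‖q t‖ * E t * ‖ext (w - w') t‖ := by ring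
            _ ≤ ‖q t‖ * E t * ‖w - w'‖ := this
            _ = _ := by ring
      _ = ‖w - w'‖ * ∫ t in (0 : ℝ)..s, ‖q t‖ * E t := intervalIntegral.integral_const_mul _ _
      _ ≤ _ := mul_le_mul_of_nonneg_left (integral_norm_mul_exp_le hq hk0 hs.1) (norm_nonneg _)
  have hEmono : Monotone E := by
    intro s t hst
    refine Real.exp_le_exp.2 (mul_le_mul_of_nonneg_left ?_ hk0.le)
    have : Q t - Q s = ∫ r in s..t, ‖q r‖ := intervalIntegral.integral_interval_sub_left
      hq.norm.intervalIntegrable hq.norm.intervalIntegrable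
    have h2 : 0 ≤ ∫ r in s..t, ‖q r‖ := intervalIntegral.integral_nonneg hst fun _ _ => norm_nonneg _
    linarith
  have hcontr : ContractingWith (1 / 2) Ψ := by
    refine ⟨by norm_num, LipschitzWith.of_dist_le_mul fun w w' => ?_⟩
    rw [dist_eq_norm, dist_eq_norm, ContinuousMap.norm_le _ (by positivity)]
    rintro ⟨x, hx⟩
    have e : (Ψ w - Ψ w') ⟨x, hx⟩ = ((E x)⁻¹ : ℝ) * ∫ s in (0 : ℝ)..x, (dv w s - dv w' s) := by
      rw [intervalIntegral.integral_sub ((hdv w).intervalIntegrable _ _)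
        ((hdv w').intervalIntegrable _ _)]
      change ((E x)⁻¹ : ℝ) * v w x - ((E x)⁻¹ : ℝ) * v w' x = _
      simp only [v]; ring
    have h1 : ‖∫ s in (0 : ℝ)..x, (dv w s - dv w' s)‖ ≤ ‖w - w'‖ * (E x / k) * |x - 0| := by
      refine intervalIntegral.norm_integral_le_of_norm_le_const fun s hs => ?_
      rw [Set.uIoc_of_le hx.1] at hs
      refine (hdiff w w' s ⟨hs.1.le, hs.2.trans hx.2⟩).trans ?_
      have := hEmono hs.2
      gcongr
    have hpos : 0 < E x := Real.exp_pos _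
    rw [e, norm_mul, Complex.norm_real, Real.norm_of_nonneg (inv_nonneg.2 hpos.le)]
    calc (E x)⁻¹ * ‖∫ s in (0 : ℝ)..x, (dv w s - dv w' s)‖
        ≤ (E x)⁻¹ * (‖w - w'‖ * (E x / k) * |x - 0|) := by gcongr
      _ = ‖w - w'‖ * (x / k) := by
          rw [sub_zero, abs_of_nonneg hx.1]; field_simp
      _ ≤ ‖w - w'‖ * (1 / 2) := by
          refine mul_le_mul_of_nonneg_left ?_ (norm_nonneg _)
          rw [div_le_div_iff₀ hk0 two_pos, hk]; linarith [hx.2]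
      _ = _ := by push_cast; ring
  set w := hcontr.fixedPoint Ψ
  have hfix : Ψ w = w := hcontr.fixedPoint_isFixedPt
  have hu : ∀ x ∈ Set.Icc 0 R, v w x = E x * ext w x := by
    intro x hx
    have h := congrArg (fun f : X => f ⟨x, hx⟩) hfix
    have h2 : ((E x)⁻¹ : ℝ) * v w x = w ⟨x, hx⟩ := h
    have h3 : ext w x = w ⟨x, hx⟩ := Set.IccExtend_of_mem _ _ hx
    have hpos : (E x : ℂ) ≠ 0 := Complex.ofReal_ne_zero.2 (Real.exp_pos _).ne'
    rw [h3, ← h2, Complex.ofReal_inv, mul_inv_cancel_left₀ hpos]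
  refine ⟨v w, dv w, hv w, fun x hx => ?_, by simp [v], by simp [dv]⟩
  simp only [dv]
  congr 1
  refine intervalIntegral.integral_congr fun t ht => ?_
  rw [Set.uIcc_of_le hx.1] at ht
  rw [hu t ⟨ht.1, ht.2.trans hx.2⟩]

/-- Integration by parts for real absolutely continuous functions given as primitives. -/
theorem integral_mul_add_mul_of_primitive {R : ℝ} (hR : 0 ≤ R) {f g f' g' : ℝ → ℝ}
    (hf' : IntervalIntegrable f' volume 0 R) (hg' : IntervalIntegrable g' volume 0 R)
    (hf : ∀ x ∈ Set.Icc 0 R, f x = f 0 + ∫ t in (0 : ℝ)..x, f' t)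
    (hg : ∀ x ∈ Set.Icc 0 R, g x = g 0 + ∫ t in (0 : ℝ)..x, g' t) :
    ∫ x in (0 : ℝ)..R, (f' x * g x + f x * g' x) = f R * g R - f 0 * g 0 := by
  have h0 : (0 : ℝ) ∈ Set.uIcc 0 R := Set.left_mem_uIcc
  have key : ∀ {p p' : ℝ → ℝ}, IntervalIntegrable p' volume 0 R →
      AbsolutelyContinuousOnInterval (fun x => p 0 + ∫ t in (0 : ℝ)..x, p' t) 0 R := by
    intro p p' hp'
    have hc : LipschitzOnWith 0 (fun _ : ℝ => p 0) (Set.uIcc 0 R) :=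
      (LipschitzWith.const _).lipschitzOnWith
    exact hc.absolutelyContinuousOnInterval.fun_add
      (hp'.absolutelyContinuousOnInterval_intervalIntegral h0)
  have h := (key (p := f) hf').integral_deriv_mul_eq_sub (key (p := g) hg')
  have hRR : R ∈ Set.Icc 0 R := Set.right_mem_Icc.2 hR
  rw [← hf R hRR, ← hg R hRR, intervalIntegral.integral_same, intervalIntegral.integral_same,
    add_zero, add_zero] at h
  rw [← h]
  refine intervalIntegral.integral_congr_ae ?_
  filter_upwards [hf'.ae_hasDerivAt_integral, hg'.ae_hasDerivAt_integral] with x hx1 hx2 hx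
  have hx' := Set.uIoc_subset_uIcc hx
  have e1 := ((hx1 hx' 0 h0).const_add (f 0)).deriv
  have e2 := ((hx2 hx' 0 h0).const_add (g 0)).deriv
  rw [Set.uIcc_of_le hR] at hx'
  rw [e1, e2, ← hf x hx', ← hg x hx']

theorem continuousOn_of_primitive {R : ℝ} (hR : 0 ≤ R) {f f' : ℝ → ℂ}
    (hf' : IntervalIntegrable f' volume 0 R)
    (hf : ∀ x ∈ Set.Icc 0 R, f x = f 0 + ∫ t in (0 : ℝ)..x, f' t) :
    ContinuousOn f (Set.Icc 0 R) := by
  have := (intervalIntegral.continuousOn_primitive_interval' hf'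
    Set.left_mem_uIcc).const_add (f 0)
  rw [Set.uIcc_of_le hR] at this
  exact this.congr hf

theorem eq_add_integral_of_hasDerivWithinAt {R : ℝ} {f f' : ℝ → ℂ}
    (hf : ∀ x ∈ Set.Icc 0 R, HasDerivWithinAt f (f' x) (Set.Icc 0 R) x)
    (hf' : ContinuousOn f' (Set.Icc 0 R)) :
    ∀ x ∈ Set.Icc 0 R, f x = f 0 + ∫ t in (0 : ℝ)..x, f' t := by
  intro x hx
  have hsub : Set.Icc 0 x ⊆ Set.Icc 0 R := Set.Icc_subset_Icc_right hx.2
  rw [intervalIntegral.integral_eq_sub_of_hasDerivAt_of_le hx.1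
    (fun y hy => (hf y (hsub hy)).continuousWithinAt.mono hsub)
    (fun y hy => (hf y (hsub (Set.Ioo_subset_Icc_self hy))).hasDerivAt
      (Icc_mem_nhds hy.1 (hy.2.trans_le hx.2)))
    ((hf'.mono hsub).intervalIntegrable_of_Icc hx.1)]
  ring

theorem re_primitive {R : ℝ} (hR : 0 ≤ R) {f f' : ℝ → ℂ}
    (hf' : IntervalIntegrable f' volume 0 R)
    (hf : ∀ x ∈ Set.Icc 0 R, f x = f 0 + ∫ t in (0 : ℝ)..x, f' t) :
    (IntervalIntegrable (fun x => (f' x).re) volume 0 R ∧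
      ∀ x ∈ Set.Icc 0 R, (f x).re = (f 0).re + ∫ t in (0 : ℝ)..x, (f' t).re) ∧
    IntervalIntegrable (fun x => (f' x).im) volume 0 R ∧
      ∀ x ∈ Set.Icc 0 R, (f x).im = (f 0).im + ∫ t in (0 : ℝ)..x, (f' t).im := by
  have hi : ∀ x ∈ Set.Icc 0 R, IntervalIntegrable f' volume 0 x := fun x hx =>
    hf'.mono_set (by
      rw [Set.uIcc_of_le hR, Set.uIcc_of_le hx.1]; exact Set.Icc_subset_Icc_right hx.2)
  refine ⟨⟨⟨hf'.1.re, hf'.2.re⟩, fun x hx => ?_⟩, ⟨⟨hf'.1.im, hf'.2.im⟩, fun x hx => ?_⟩⟩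
  · rw [hf x hx, Complex.add_re]
    exact congrArg _ (Complex.reCLM.intervalIntegral_comp_comm (hi x hx)).symm
  · rw [hf x hx, Complex.add_im]
    exact congrArg _ (Complex.imCLM.intervalIntegral_comp_comm (hi x hx)).symm

/-- The energy identity for `u'' = q`. -/
theorem integral_normSq_deriv_add {R : ℝ} (hR : 0 ≤ R) {u du q : ℝ → ℂ}
    (hu : ∀ x ∈ Set.Icc 0 R, HasDerivWithinAt u (du x) (Set.Icc 0 R) x)
    (hq : IntervalIntegrable q volume 0 R)
    (hdu : ∀ x ∈ Set.Icc 0 R, du x = du 0 + ∫ t in (0 : ℝ)..x, q t) :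
    (∫ x in (0 : ℝ)..R, ‖du x‖ ^ 2) + ∫ x in (0 : ℝ)..R, (starRingEnd ℂ (u x) * q x).re
      = (starRingEnd ℂ (u R) * du R).re - (starRingEnd ℂ (u 0) * du 0).re := by
  have hduc := continuousOn_of_primitive hR hq hdu
  have hup := eq_add_integral_of_hasDerivWithinAt hu hduc
  have huc : ContinuousOn u (Set.Icc 0 R) := fun x hx => (hu x hx).continuousWithinAt
  have hdui : IntervalIntegrable du volume 0 R := hduc.intervalIntegrable_of_Icc hR
  obtain ⟨⟨a1, a2⟩, a3, a4⟩ := re_primitive hR hq hdu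
  obtain ⟨⟨b1, b2⟩, b3, b4⟩ := re_primitive hR hdui hup
  have e1 := integral_mul_add_mul_of_primitive hR b1 a1 b2 a2
  have e2 := integral_mul_add_mul_of_primitive hR b3 a3 b4 a4
  have hri : ∀ {f : ℝ → ℂ}, ContinuousOn f (Set.Icc 0 R) →
      ContinuousOn (fun x => (f x).re) (Set.uIcc 0 R) ∧
      ContinuousOn (fun x => (f x).im) (Set.uIcc 0 R) := fun hf => by
    rw [Set.uIcc_of_le hR]
    exact ⟨Complex.continuous_re.comp_continuousOn hf, Complex.continuous_im.comp_continuousOn hf⟩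
  have i1 := (b1.mul_continuousOn (hri hduc).1).add (a1.continuousOn_mul (hri huc).1)
  have i2 := (b3.mul_continuousOn (hri hduc).2).add (a3.continuousOn_mul (hri huc).2)
  have hq' : IntervalIntegrable (fun x => starRingEnd ℂ (u x) * q x) volume 0 R :=
    hq.continuousOn_mul (by
      rw [Set.uIcc_of_le hR]; exact Complex.continuous_conj.comp_continuousOn huc)
  have hdu2 : IntervalIntegrable (fun t => ‖du t‖ ^ 2) volume 0 R :=
    (hduc.norm.pow 2).intervalIntegrable_of_Icc hR
  have hq2 : IntervalIntegrable (fun x => (starRingEnd ℂ (u x) * q x).re) volume 0 R :=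
    ⟨hq'.1.re, hq'.2.re⟩
  rw [← intervalIntegral.integral_add hdu2 hq2]
  have e3 := congrArg₂ (· + ·) e1 e2
  rw [← intervalIntegral.integral_add i1 i2] at e3
  have e4 : ∀ x, ‖du x‖ ^ 2 + (starRingEnd ℂ (u x) * q x).re
      = (du x).re * (du x).re + (u x).re * (q x).re
        + ((du x).im * (du x).im + (u x).im * (q x).im) := by
    intro x
    rw [← Complex.normSq_eq_norm_sq, Complex.normSq_apply]
    simp only [Complex.mul_re, Complex.conj_re, Complex.conj_im]
    ring
  simp only [e4]
  refine e3.trans ?_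
  simp only [Complex.mul_re, Complex.conj_re, Complex.conj_im]
  ring

/-- A Sobolev-type inequality on `[0,R]`. -/
theorem normSq_le_of_deriv {R : ℝ} (hR : 0 < R) {u du : ℝ → ℂ}
    (hu : ∀ x ∈ Set.Icc 0 R, HasDerivWithinAt u (du x) (Set.Icc 0 R) x)
    (hduc : ContinuousOn du (Set.Icc 0 R)) {ε : ℝ} (hε : 0 < ε) {x : ℝ} (hx : x ∈ Set.Icc 0 R) :
    ‖u x‖ ^ 2 ≤ (∫ t in (0 : ℝ)..R, ‖u t‖ ^ 2) / R + (∫ t in (0 : ℝ)..R, ‖u t‖ ^ 2) / ε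
      + ε * ∫ t in (0 : ℝ)..R, ‖du t‖ ^ 2 := by
  have huc : ContinuousOn u (Set.Icc 0 R) := fun x hx => (hu x hx).continuousWithinAt
  have hui : IntervalIntegrable (fun t => ‖u t‖ ^ 2) volume 0 R :=
    (huc.norm.pow 2).intervalIntegrable_of_Icc hR.le
  have hdui : IntervalIntegrable (fun t => ‖du t‖ ^ 2) volume 0 R :=
    (hduc.norm.pow 2).intervalIntegrable_of_Icc hR.le
  set B := ∫ t in (0 : ℝ)..R, ‖u t‖ ^ 2
  set A := ∫ t in (0 : ℝ)..R, ‖du t‖ ^ 2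
  let w' : ℝ → ℝ := fun t => 2 * (starRingEnd ℂ (u t) * du t).re
  have hw : ∀ y ∈ Set.Icc 0 R, HasDerivWithinAt (fun y => ‖u y‖ ^ 2) (w' y) (Set.Icc 0 R) y := by
    intro y hy
    have h1 := Complex.reCLM.hasFDerivAt.comp_hasDerivWithinAt y (hu y hy)
    have h2 := Complex.imCLM.hasFDerivAt.comp_hasDerivWithinAt y (hu y hy)
    refine ((h1.mul h1).add (h2.mul h2)).congr_of_mem (fun z _ => ?_) hy |>.congr_deriv ?_
    · rw [← Complex.normSq_eq_norm_sq, Complex.normSq_apply]; rfl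
    · simp only [w', Complex.mul_re, Complex.conj_re, Complex.conj_im, Function.comp,
        Complex.reCLM_apply, Complex.imCLM_apply]
      ring
  have hw'c : ContinuousOn w' (Set.Icc 0 R) :=
    continuousOn_const.mul (Complex.continuous_re.comp_continuousOn
      ((Complex.continuous_conj.comp_continuousOn huc).mul hduc))
  have hdiff : ∀ y ∈ Set.Icc 0 R, ‖u x‖ ^ 2 - ‖u y‖ ^ 2 ≤ B / ε + ε * A := by
    intro y hy
    have hsub : Set.uIcc y x ⊆ Set.Icc 0 R := Set.uIcc_subset_Icc hy hx
    rw [← intervalIntegral.integral_eq_sub_of_hasDeriv_right (f' := w')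
      (fun t ht => (hw t (hsub ht)).continuousWithinAt.mono hsub) (fun t ht => by
        have h1 : t ∈ Set.Icc 0 R := hsub (Set.Ioo_subset_Icc_self ht)
        have h2 : Set.Icc 0 R ∈ nhds t := Icc_mem_nhds
          ((le_min hy.1 hx.1).trans_lt ht.1) (ht.2.trans_le (max_le hy.2 hx.2))
        exact ((hw t h1).hasDerivAt h2).hasDerivWithinAt)
      (hw'c.mono hsub).intervalIntegrable]
    have hb : ∀ t, ‖w' t‖ ≤ ‖u t‖ ^ 2 / ε + ε * ‖du t‖ ^ 2 := by
      intro t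
      have h1 : |(starRingEnd ℂ (u t) * du t).re| ≤ ‖u t‖ * ‖du t‖ := by
        refine (Complex.abs_re_le_norm _).trans_eq ?_
        rw [norm_mul, RCLike.norm_conj]
      have h2 : 2 * (‖u t‖ * ‖du t‖) ≤ ‖u t‖ ^ 2 / ε + ε * ‖du t‖ ^ 2 := by
        have h3 : ‖u t‖ ^ 2 / ε + ε * ‖du t‖ ^ 2 - 2 * (‖u t‖ * ‖du t‖)
            = (‖u t‖ - ε * ‖du t‖) ^ 2 / ε := by field_simp; ring
        have : 0 ≤ (‖u t‖ - ε * ‖du t‖) ^ 2 / ε := by positivity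
        linarith
      rw [Real.norm_eq_abs, abs_mul, abs_two]
      linarith
    have hint := (hui.div_const ε).add (hdui.const_mul ε)
    have hbi : ∫ t in (0 : ℝ)..R, (‖u t‖ ^ 2 / ε + ε * ‖du t‖ ^ 2) = B / ε + ε * A := by
      rw [intervalIntegral.integral_add (hui.div_const ε) (hdui.const_mul ε),
        intervalIntegral.integral_div, intervalIntegral.integral_const_mul]
    rw [← hbi, intervalIntegral.integral_of_le hR.le]
    calc ∫ t in y..x, w' t ≤ ‖∫ t in y..x, w' t‖ := Real.le_norm_self _
      _ ≤ ∫ t in Set.uIoc y x, ‖w' t‖ := intervalIntegral.norm_integral_le_integral_norm_uIoc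
      _ ≤ ∫ t in Set.uIoc y x, (‖u t‖ ^ 2 / ε + ε * ‖du t‖ ^ 2) := by
          refine setIntegral_mono (hw'c.mono hsub).intervalIntegrable.def'.norm ?_ hb
          refine (intervalIntegrable_iff.1 hint).mono_set ?_
          rw [Set.uIoc_of_le hR.le]
          exact Set.Ioc_subset_Ioc (le_min hy.1 hx.1) (max_le hy.2 hx.2)
      _ ≤ _ := by
          refine setIntegral_mono_set ((intervalIntegrable_iff_integrableOn_Ioc_of_le hR.le).1 hint)
            (ae_of_all _ fun t => by simp only [Pi.zero_apply]; positivity)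
            (LE.le.eventuallyLE ?_)
          exact Set.Ioc_subset_Ioc (le_min hy.1 hx.1) (max_le hy.2 hx.2)
  have h := intervalIntegral.integral_mono_on (μ := volume) hR.le
    (intervalIntegrable_const (c := ‖u x‖ ^ 2 - (B / ε + ε * A))) hui
    (fun y hy => by have := hdiff y hy; linarith)
  rw [intervalIntegral.integral_const, sub_zero, smul_eq_mul, mul_comm, ← le_div_iff₀ hR] at h
  change _ ≤ B / R at h
  linarith

/-- The energy estimate for `-u'' + V u = h` with Robin-type boundary behaviour. -/
theorem integral_normSq_deriv_le {R : ℝ} (hR : 0 < R) {V : ℝ → ℝ}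
    (hV : IntervalIntegrable V volume 0 R) {u du h : ℝ → ℂ}
    (hu : ∀ x ∈ Set.Icc 0 R, HasDerivWithinAt u (du x) (Set.Icc 0 R) x)
    (hh : IntervalIntegrable h volume 0 R)
    (hdu : ∀ x ∈ Set.Icc 0 R, du x = du 0 + ∫ t in (0 : ℝ)..x, (V t * u t - h t))
    {c d M : ℝ} (hc : 0 ≤ c) (hd : 0 ≤ d) (hM : ∀ x ∈ Set.Icc 0 R, ‖u x‖ ≤ M)
    (h0 : ‖u 0‖ * ‖du 0‖ ≤ c * ‖u 0‖ ^ 2 + d * ‖u 0‖)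
    (h1 : ‖u R‖ * ‖du R‖ ≤ c * ‖u R‖ ^ 2 + d * ‖u R‖) :
    ∫ x in (0 : ℝ)..R, ‖du x‖ ^ 2 ≤ ((∫ x in (0 : ℝ)..R, |V x|) + 2 * c) * M ^ 2 + 2 * d * M
      + ∫ x in (0 : ℝ)..R, (starRingEnd ℂ (u x) * h x).re := by
  have huc : ContinuousOn u (Set.uIcc 0 R) := by
    rw [Set.uIcc_of_le hR.le]; exact fun x hx => (hu x hx).continuousWithinAt
  have hVC : IntervalIntegrable (fun t => (V t : ℂ)) volume 0 R := ⟨hV.1.ofReal, hV.2.ofReal⟩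
  have hq := (hVC.mul_continuousOn huc).sub hh
  have e := integral_normSq_deriv_add hR.le hu hq hdu
  have hcu : ContinuousOn (fun t => starRingEnd ℂ (u t)) (Set.uIcc 0 R) :=
    Complex.continuous_conj.comp_continuousOn huc
  have hch := hh.continuousOn_mul hcu
  have hch' : IntervalIntegrable (fun t => (starRingEnd ℂ (u t) * h t).re) volume 0 R :=
    ⟨hch.1.re, hch.2.re⟩
  have hVu : IntervalIntegrable (fun t => V t * ‖u t‖ ^ 2) volume 0 R :=
    hV.mul_continuousOn (huc.norm.pow 2)
  have e2 : ∫ x in (0 : ℝ)..R, (starRingEnd ℂ (u x) * (V x * u x - h x)).re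
      = (∫ x in (0 : ℝ)..R, V x * ‖u x‖ ^ 2)
        - ∫ x in (0 : ℝ)..R, (starRingEnd ℂ (u x) * h x).re := by
    rw [← intervalIntegral.integral_sub hVu hch']
    refine intervalIntegral.integral_congr fun x _ => ?_
    simp only [← Complex.normSq_eq_norm_sq, Complex.normSq_apply, Complex.mul_re, Complex.sub_re,
      Complex.sub_im, Complex.conj_re, Complex.conj_im, Complex.mul_im, Complex.ofReal_re,
      Complex.ofReal_im]
    ring
  have e3 : |∫ x in (0 : ℝ)..R, V x * ‖u x‖ ^ 2| ≤ (∫ x in (0 : ℝ)..R, |V x|) * M ^ 2 := by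
    rw [← intervalIntegral.integral_mul_const]
    rw [← Real.norm_eq_abs]
    refine intervalIntegral.norm_integral_le_of_norm_le hR.le (ae_of_all _ fun t ht => ?_)
      (hV.abs.mul_const _)
    rw [norm_mul, Real.norm_eq_abs, norm_pow, norm_norm]
    have := hM t ⟨ht.1.le, ht.2⟩
    gcongr
  have hbt : ∀ a b : ℂ, ‖a‖ * ‖b‖ ≤ c * ‖a‖ ^ 2 + d * ‖a‖ → ‖a‖ ≤ M →
      |(starRingEnd ℂ a * b).re| ≤ c * M ^ 2 + d * M := by
    intro a b hab ha
    calc |(starRingEnd ℂ a * b).re| ≤ ‖a‖ * ‖b‖ :=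
          (Complex.abs_re_le_norm _).trans_eq (by rw [norm_mul, RCLike.norm_conj])
      _ ≤ _ := hab
      _ ≤ _ := by gcongr
  have b0 := abs_le.1 (hbt _ _ h0 (hM 0 ⟨le_rfl, hR.le⟩))
  have b1 := abs_le.1 (hbt _ _ h1 (hM R ⟨hR.le, le_rfl⟩))
  have e3' := abs_le.1 e3
  rw [e2] at e
  linarith [b0.1, b1.2, e3'.1]

theorem half_integral_normSq_deriv_le {R : ℝ} (hR : 0 < R) {V : ℝ → ℝ}
    (hV : IntervalIntegrable V volume 0 R) {u du h : ℝ → ℂ}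
    (hu : ∀ x ∈ Set.Icc 0 R, HasDerivWithinAt u (du x) (Set.Icc 0 R) x)
    (hh : IntervalIntegrable h volume 0 R)
    (hdu : ∀ x ∈ Set.Icc 0 R, du x = du 0 + ∫ t in (0 : ℝ)..x, (V t * u t - h t))
    {c d k : ℝ} (hc : 0 ≤ c) (hd : 0 ≤ d)
    (h0 : ‖u 0‖ * ‖du 0‖ ≤ c * ‖u 0‖ ^ 2 + d * ‖u 0‖)
    (h1 : ‖u R‖ * ‖du R‖ ≤ c * ‖u R‖ ^ 2 + d * ‖u R‖)
    (hk : k = (∫ x in (0 : ℝ)..R, |V x|) + 2 * c + 1) :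
    (∫ x in (0 : ℝ)..R, ‖du x‖ ^ 2) / 2 ≤ k * (1 / R + 2 * k) * (∫ x in (0 : ℝ)..R, ‖u x‖ ^ 2)
      + d ^ 2 + ∫ x in (0 : ℝ)..R, (starRingEnd ℂ (u x) * h x).re := by
  have hVC : IntervalIntegrable (fun t => (V t : ℂ)) volume 0 R := ⟨hV.1.ofReal, hV.2.ofReal⟩
  have huc : ContinuousOn u (Set.uIcc 0 R) := by
    rw [Set.uIcc_of_le hR.le]; exact fun x hx => (hu x hx).continuousWithinAt
  have hduc := continuousOn_of_primitive hR.le ((hVC.mul_continuousOn huc).sub hh) hdu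
  have hK : 0 ≤ ∫ x in (0 : ℝ)..R, |V x| :=
    intervalIntegral.integral_nonneg hR.le fun _ _ => abs_nonneg _
  have hk0 : 0 < k := by rw [hk]; positivity
  have hA : 0 ≤ ∫ x in (0 : ℝ)..R, ‖du x‖ ^ 2 :=
    intervalIntegral.integral_nonneg hR.le fun _ _ => by positivity
  have hB : 0 ≤ ∫ x in (0 : ℝ)..R, ‖u x‖ ^ 2 :=
    intervalIntegral.integral_nonneg hR.le fun _ _ => by positivity
  have hs := fun x hx =>
    normSq_le_of_deriv hR hu hduc (ε := 1 / (2 * k)) (by positivity) (x := x) hx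
  set A := ∫ x in (0 : ℝ)..R, ‖du x‖ ^ 2
  set B := ∫ x in (0 : ℝ)..R, ‖u x‖ ^ 2
  set m := B / R + B / (1 / (2 * k)) + 1 / (2 * k) * A with hm
  have hm0 : 0 ≤ m := by positivity
  have key := integral_normSq_deriv_le hR hV hu hh hdu hc hd (M := √m)
    (fun x hx => Real.le_sqrt_of_sq_le (hs x hx)) h0 h1
  have hsq : √m ^ 2 = m := Real.sq_sqrt hm0
  have h2 : 2 * d * √m ≤ d ^ 2 + m := by nlinarith [sq_nonneg (d - √m)]
  have h3 : k * m = k * (1 / R + 2 * k) * B + A / 2 := by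
    rw [hm]; field_simp
  rw [hsq] at key
  have h4 : ((∫ x in (0 : ℝ)..R, |V x|) + 2 * c) * m = k * m - m := by rw [hk]; ring
  linarith

theorem memLp_of_continuousOn {R : ℝ} {u : ℝ → ℂ} (hu : ContinuousOn u (Set.Icc 0 R)) :
    MemLp u 2 (volume.restrict (Set.Ioo 0 R)) := by
  obtain ⟨C, hC⟩ := isCompact_Icc.exists_bound_of_continuousOn hu
  exact MemLp.of_bound ((hu.mono Set.Ioo_subset_Icc_self).aestronglyMeasurable measurableSet_Ioo) C
    ((ae_restrict_mem measurableSet_Ioo).mono fun x hx => hC x (Set.Ioo_subset_Icc_self hx))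

/-- The class in `L²((0,R))` of a function (junk value `0` if it is not square integrable). -/
def toSch (R : ℝ) (u : ℝ → ℂ) : SchSp R :=
  if h : MemLp u 2 (volume.restrict (Set.Ioo 0 R)) then h.toLp u else 0

theorem coeFn_toSch {R : ℝ} {u : ℝ → ℂ} (hu : ContinuousOn u (Set.Icc 0 R)) :
    ∀ᵐ x ∂(volume.restrict (Set.Ioo 0 R)), toSch R u x = u x := by
  rw [toSch, dif_pos (memLp_of_continuousOn hu)]
  exact MemLp.coeFn_toLp _

theorem eq_toSch {R : ℝ} {u : ℝ → ℂ} (hu : ContinuousOn u (Set.Icc 0 R)) {f : SchSp R}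
    (hf : ∀ᵐ x ∂(volume.restrict (Set.Ioo 0 R)), f x = u x) : f = toSch R u := by
  refine Lp.ext ?_
  filter_upwards [hf, coeFn_toSch hu] with x h1 h2
  rw [h1, h2]

theorem toSch_add {R : ℝ} {u v : ℝ → ℂ} (hu : ContinuousOn u (Set.Icc 0 R))
    (hv : ContinuousOn v (Set.Icc 0 R)) : toSch R (u + v) = toSch R u + toSch R v := by
  refine (eq_toSch (hu.add hv) ?_).symm
  filter_upwards [coeFn_toSch hu, coeFn_toSch hv, Lp.coeFn_add (toSch R u) (toSch R v)]
    with x h1 h2 h3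
  rw [h3, Pi.add_apply, Pi.add_apply, h1, h2]

theorem toSch_smul {R : ℝ} {u : ℝ → ℂ} (hu : ContinuousOn u (Set.Icc 0 R)) (a : ℂ) :
    toSch R (a • u) = a • toSch R u := by
  refine (eq_toSch (hu.const_smul a) ?_).symm
  filter_upwards [coeFn_toSch hu, Lp.coeFn_smul a (toSch R u)] with x h1 h3
  rw [h3, Pi.smul_apply, Pi.smul_apply, h1]

theorem intervalIntegral_eq_of_le {E : Type*} [NormedAddCommGroup E] [NormedSpace ℝ E] {R : ℝ}
    (hR : 0 ≤ R) (f : ℝ → E) :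
    ∫ x in (0 : ℝ)..R, f x = ∫ x in Set.Ioo 0 R, f x := by
  rw [intervalIntegral.integral_of_le hR, integral_Ioc_eq_integral_Ioo]

theorem intervalIntegrable_iff_Ioo {E : Type*} [NormedAddCommGroup E] {R : ℝ} (hR : 0 ≤ R)
    {f : ℝ → E} : IntervalIntegrable f volume 0 R ↔ IntegrableOn f (Set.Ioo 0 R) := by
  rw [intervalIntegrable_iff_integrableOn_Ioc_of_le hR, integrableOn_Ioc_iff_integrableOn_Ioo]

theorem norm_sq_eq_integral {R : ℝ} (hR : 0 ≤ R) {f : SchSp R} {u : ℝ → ℂ}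
    (hf : ∀ᵐ x ∂(volume.restrict (Set.Ioo 0 R)), f x = u x) :
    ‖f‖ ^ 2 = ∫ x in (0 : ℝ)..R, ‖u x‖ ^ 2 := by
  have h := L2.inner_def (𝕜 := ℂ) f f
  rw [inner_self_eq_ofReal] at h
  rw [intervalIntegral_eq_of_le hR]
  have h2 : ∫ x in Set.Ioo 0 R, ⟪f x, f x⟫_ℂ = ((∫ x in Set.Ioo 0 R, ‖u x‖ ^ 2 : ℝ) : ℂ) := by
    refine Eq.trans ?_ integral_ofReal
    refine integral_congr_ae ?_
    filter_upwards [hf] with x hx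
    rw [inner_self_eq_ofReal, hx]
    rfl
  rw [h2] at h
  exact Complex.ofReal_injective h

theorem integrable_of_rep {R : ℝ} (hR : 0 ≤ R) {h : SchSp R} {h0 : ℝ → ℂ}
    (hh : ∀ᵐ x ∂(volume.restrict (Set.Ioo 0 R)), h x = h0 x) :
    IntervalIntegrable h0 volume 0 R := by
  rw [intervalIntegrable_iff_Ioo hR]
  exact ((Lp.memLp h).integrable one_le_two).congr hh

theorem re_inner_eq_integral {R : ℝ} (hR : 0 ≤ R) {f h : SchSp R} {u h0 : ℝ → ℂ}
    (hf : ∀ᵐ x ∂(volume.restrict (Set.Ioo 0 R)), f x = u x)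
    (hh : ∀ᵐ x ∂(volume.restrict (Set.Ioo 0 R)), h x = h0 x) :
    (⟪f, h⟫_ℂ).re = ∫ x in (0 : ℝ)..R, (starRingEnd ℂ (u x) * h0 x).re := by
  rw [L2.inner_def, intervalIntegral_eq_of_le hR]
  have := integral_re (L2.integrable_inner (𝕜 := ℂ) f h)
  refine this.symm.trans (integral_congr_ae ?_)
  filter_upwards [hf, hh] with x h1 h2
  rw [h1, h2, RCLike.inner_apply, mul_comm]
  rfl

theorem bdryC_add (R : ℝ) (t0 tR : ℂ) (u du v dv : ℝ → ℂ) :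
    bdryC R t0 tR (u + v) (du + dv) = bdryC R t0 tR u du + bdryC R t0 tR v dv := by
  ext i; fin_cases i <;> simp [bdryC] <;> ring

theorem bdryC_smul (R : ℝ) (t0 tR a : ℂ) (u du : ℝ → ℂ) :
    bdryC R t0 tR (a • u) (a • du) = a • bdryC R t0 tR u du := by
  ext i; fin_cases i <;> simp [bdryC] <;> ring

section
variable {R : ℝ} {V : ℝ → ℂ} {z w : ℂ} {u du v dv : ℝ → ℂ}

theorem SolODE.continuousOn (hu : SolODE R V z u du) : ContinuousOn u (Set.Icc 0 R) :=
  fun x hx => (hu.1 x hx).continuousWithinAt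

theorem intervalIntegrable_mul_of_mem (hV : IntervalIntegrable V volume 0 R)
    (hu : ContinuousOn u (Set.Icc 0 R)) {x : ℝ} (hx : x ∈ Set.Icc 0 R) :
    IntervalIntegrable (fun t => V t * u t) volume 0 x := by
  have hs : Set.uIcc 0 x ⊆ Set.Icc 0 R := by
    rw [Set.uIcc_of_le hx.1]; exact Set.Icc_subset_Icc_right hx.2
  refine (hV.mono_set ?_).mul_continuousOn (hu.mono hs)
  rwa [Set.uIcc_of_le (hx.1.trans hx.2)]

theorem SolODE.intervalIntegrable (hV : IntervalIntegrable V volume 0 R)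
    (hu : SolODE R V z u du) {x : ℝ} (hx : x ∈ Set.Icc 0 R) :
    IntervalIntegrable (fun t => (V t - z) * u t) volume 0 x :=
  intervalIntegrable_mul_of_mem (hV.sub intervalIntegrable_const) hu.continuousOn hx

theorem SolODE.add (hV : IntervalIntegrable V volume 0 R)
    (hu : SolODE R V z u du) (hv : SolODE R V z v dv) : SolODE R V z (u + v) (du + dv) := by
  refine ⟨fun x hx => (hu.1 x hx).add (hv.1 x hx), fun x hx => ?_⟩
  simp only [Pi.add_apply, mul_add]
  rw [intervalIntegral.integral_add (hu.intervalIntegrable hV hx) (hv.intervalIntegrable hV hx),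
    hu.2 x hx, hv.2 x hx]
  ring

theorem SolODE.smul (hu : SolODE R V z u du) (a : ℂ) : SolODE R V z (a • u) (a • du) := by
  refine ⟨fun x hx => (hu.1 x hx).const_smul a, fun x hx => ?_⟩
  simp only [Pi.smul_apply, smul_eq_mul, mul_left_comm _ a]
  rw [intervalIntegral.integral_const_mul, hu.2 x hx]
  ring

variable {t0 tR : ℂ} {Hop : SchSp R →ₗ.[ℂ] SchSp R}

/-- A nonzero solution satisfying the boundary condition is an eigenfunction. -/
theorem IsSchrodingerOp.toSch_eq_zero (hOp : IsSchrodingerOp R V t0 tR Hop)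
    (hz : z ∈ resolventSetP Hop) (hu : SolODE R V z u du) (hb : bdryC R t0 tR u du = 0) :
    toSch R u = 0 := by
  have h : (toSch R u, (0 : SchSp R) + z • toSch R u) ∈ Hop.graph := by
    refine (hOp _ _).2 ⟨u, du, ⟨coeFn_toSch hu.continuousOn, hu.1, fun t => z * u t, ?_, ?_⟩, hb⟩
    · rw [zero_add, ← toSch_smul hu.continuousOn]
      exact coeFn_toSch (hu.continuousOn.const_smul z)
    · intro x hx
      rw [hu.2 x hx]
      congr 1
      exact intervalIntegral.integral_congr fun t _ => by ring
  rw [← res_apply_of_mem_graph hz h, map_zero]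

theorem SolODE.eq_zero_of_toSch (hR : 0 < R) (hV : IntervalIntegrable V volume 0 R)
    (hu : SolODE R V z u du) (h : toSch R u = 0) :
    ∀ x ∈ Set.Icc 0 R, u x = 0 ∧ du x = 0 := by
  have hduc := continuousOn_of_primitive hR.le
    (hu.intervalIntegrable hV (Set.right_mem_Icc.2 hR.le)) hu.2
  have hB := norm_sq_eq_integral hR.le (coeFn_toSch hu.continuousOn)
  rw [h, norm_zero, zero_pow two_ne_zero] at hB
  have hux : ∀ x ∈ Set.Icc 0 R, u x = 0 := by
    intro x hx
    have h1 : ‖u x‖ ^ 2 ≤ 0 := by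
      refine le_of_forall_pos_le_add fun ε hε => ?_
      have hA : 0 ≤ ∫ t in (0 : ℝ)..R, ‖du t‖ ^ 2 :=
        intervalIntegral.integral_nonneg hR.le fun _ _ => by positivity
      set A := ∫ t in (0 : ℝ)..R, ‖du t‖ ^ 2 with hAdef
      have := normSq_le_of_deriv hR hu.1 hduc (ε := ε / (A + 1)) (by positivity) hx
      rw [← hB, ← hAdef, zero_div, zero_div, zero_add, zero_add] at this
      refine this.trans ?_
      rw [zero_add, div_mul_eq_mul_div, div_le_iff₀ (by positivity)]
      nlinarith
    have h2 : ‖u x‖ = 0 := by nlinarith [norm_nonneg (u x)]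
    exact norm_eq_zero.1 h2
  refine fun x hx => ⟨hux x hx, ?_⟩
  have h1 := (hu.1 x hx).congr_of_mem (f₁ := fun _ => (0 : ℂ)) (fun y hy => (hux y hy).symm) hx
  exact (uniqueDiffOn_Icc hR x hx).eq_deriv _ h1 (hasDerivWithinAt_const _ _ _)

theorem IsSchrodingerOp.eq_zero (hR : 0 < R) (hV : IntervalIntegrable V volume 0 R)
    (hOp : IsSchrodingerOp R V t0 tR Hop)
    (hz : z ∈ resolventSetP Hop) (hu : SolODE R V z u du) (hb : bdryC R t0 tR u du = 0) :
    ∀ x ∈ Set.Icc 0 R, u x = 0 ∧ du x = 0 :=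
  hu.eq_zero_of_toSch hR hV (hOp.toSch_eq_zero hz hu hb)

/-- Two solutions with the same boundary values agree. -/
theorem IsSchrodingerOp.toSch_congr (hV : IntervalIntegrable V volume 0 R)
    (hOp : IsSchrodingerOp R V t0 tR Hop) (hz : z ∈ resolventSetP Hop)
    (hu : SolODE R V z u du) (hv : SolODE R V z v dv)
    (hb : bdryC R t0 tR u du = bdryC R t0 tR v dv) : toSch R u = toSch R v := by
  have h := hOp.toSch_eq_zero hz (hu.add hV (hv.smul (-1))) (by
    rw [bdryC_add, bdryC_smul, hb, neg_one_smul, add_neg_cancel])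
  rwa [toSch_add hu.continuousOn (hv.continuousOn.const_smul _), toSch_smul hv.continuousOn,
    neg_one_smul, add_neg_eq_zero] at h

/-- The action of the resolvent on a solution at another spectral parameter. -/
theorem IsSchrodingerOp.res_toSch (hV : IntervalIntegrable V volume 0 R)
    (hOp : IsSchrodingerOp R V t0 tR Hop) (hz : z ∈ resolventSetP Hop) (hwz : w ≠ z)
    (hu : SolODE R V w u du) (hv : SolODE R V z v dv)
    (hb : bdryC R t0 tR u du = bdryC R t0 tR v dv) :
    res Hop z (toSch R u) = (w - z)⁻¹ • (toSch R u - toSch R v) := by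
  have hwz' : w - z ≠ 0 := sub_ne_zero.2 hwz
  have hgc : ContinuousOn ((w - z)⁻¹ • (u + (-1 : ℂ) • v)) (Set.Icc 0 R) :=
    (hu.continuousOn.add (hv.continuousOn.const_smul _)).const_smul _
  have e : (w - z)⁻¹ • (toSch R u - toSch R v) = toSch R ((w - z)⁻¹ • (u + (-1 : ℂ) • v)) := by
    rw [toSch_smul (hu.continuousOn.add (hv.continuousOn.const_smul _)),
      toSch_add hu.continuousOn (hv.continuousOn.const_smul _), toSch_smul hv.continuousOn,
      neg_one_smul, ← sub_eq_add_neg]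
  rw [e]
  refine res_apply_of_mem_graph hz ((hOp _ _).2
    ⟨(w - z)⁻¹ • (u + (-1 : ℂ) • v), (w - z)⁻¹ • (du + (-1 : ℂ) • dv),
      ⟨coeFn_toSch hgc, fun x hx => ((hu.1 x hx).add ((hv.1 x hx).const_smul _)).const_smul _,
        u + z • ((w - z)⁻¹ • (u + (-1 : ℂ) • v)), ?_, fun x hx => ?_⟩, ?_⟩)
  · rw [← toSch_smul hgc, ← toSch_add hu.continuousOn (hgc.const_smul _)]
    exact coeFn_toSch (hu.continuousOn.add (hgc.const_smul _))
  · have e2 : ∀ t, V t * ((w - z)⁻¹ • (u + (-1 : ℂ) • v)) t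
        - 0 * ((w - z)⁻¹ • (u + (-1 : ℂ) • v)) t
        - (u + z • ((w - z)⁻¹ • (u + (-1 : ℂ) • v))) t
        = (w - z)⁻¹ * ((V t - w) * u t - (V t - z) * v t) := by
      intro t
      simp only [Pi.add_apply, Pi.smul_apply, smul_eq_mul]
      field_simp
      ring
    simp only [e2]
    rw [intervalIntegral.integral_const_mul, intervalIntegral.integral_sub
      (hu.intervalIntegrable hV hx) (hv.intervalIntegrable hV hx)]
    simp only [Pi.add_apply, Pi.smul_apply, smul_eq_mul]
    rw [hu.2 x hx, hv.2 x hx]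
    ring
  · rw [bdryC_smul, bdryC_add, bdryC_smul, hb, neg_one_smul, add_neg_cancel, smul_zero]

/-- Solvability of the boundary value problem off the spectrum. -/
theorem IsSchrodingerOp.exists_solODE (hR : 0 < R) (hV : IntervalIntegrable V volume 0 R)
    (hOp : IsSchrodingerOp R V t0 tR Hop) (hz : z ∈ resolventSetP Hop) (c : Fin 2 → ℂ) :
    ∃ u du, SolODE R V z u du ∧ bdryC R t0 tR u du = c := by
  have hq : Integrable ((Set.Ioc 0 R).indicator fun t => V t - z) :=
    ((intervalIntegrable_iff_integrableOn_Ioc_of_le hR.le).1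
      (hV.sub intervalIntegrable_const)).integrable_indicator measurableSet_Ioc
  have hex : ∀ a b : ℂ, ∃ u du, SolODE R V z u du ∧ u 0 = a ∧ du 0 = b := by
    intro a b
    obtain ⟨u, du, h1, h2, h3, h4⟩ := exists_ivp_solution hR hq a b
    refine ⟨u, du, ⟨fun x _ => (h1 x).hasDerivWithinAt, fun x hx => ?_⟩, h3, h4⟩
    rw [h2 x hx, h4]
    congr 1
    refine intervalIntegral.integral_congr_ae (ae_of_all _ fun t ht => ?_)
    rw [Set.uIoc_of_le hx.1] at ht
    have htR : t ∈ Set.Ioc 0 R := ⟨ht.1, ht.2.trans hx.2⟩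
    rw [Set.indicator_of_mem htR]
  obtain ⟨u, du, hu, hu0, hdu0⟩ := hex 1 0
  obtain ⟨v, dv, hv, hv0, hdv0⟩ := hex 0 1
  let L : (Fin 2 → ℂ) →ₗ[ℂ] (Fin 2 → ℂ) :=
    (LinearMap.proj 0).smulRight (bdryC R t0 tR u du)
      + (LinearMap.proj 1).smulRight (bdryC R t0 tR v dv)
  have hL : ∀ a, L a = bdryC R t0 tR (a 0 • u + a 1 • v) (a 0 • du + a 1 • dv) := by
    intro a
    rw [bdryC_add, bdryC_smul, bdryC_smul]
    rfl
  have hsol : ∀ a : Fin 2 → ℂ, SolODE R V z (a 0 • u + a 1 • v) (a 0 • du + a 1 • dv) :=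
    fun a => (hu.smul _).add hV (hv.smul _)
  have hinj : Function.Injective L := by
    refine (injective_iff_map_eq_zero _).2 fun a ha => ?_
    rw [hL] at ha
    have h := hOp.eq_zero hR hV hz (hsol a) ha 0 ⟨le_rfl, hR.le⟩
    simp only [Pi.add_apply, Pi.smul_apply, hu0, hv0, hdu0, hdv0, smul_eq_mul, mul_one, mul_zero,
      add_zero, zero_add] at h
    ext i; fin_cases i
    · exact h.1
    · exact h.2
  obtain ⟨a, ha⟩ := (LinearMap.injective_iff_surjective.1 hinj) c
  exact ⟨_, _, hsol a, (hL a).symm.trans ha⟩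

/-- The difference of two resolvents takes values in the solution space. -/
theorem IsSchrodingerOp.exists_res_sub_res (hR : 0 < R) (hV : IntervalIntegrable V volume 0 R)
    {t0' tR' : ℂ} {Hop' : SchSp R →ₗ.[ℂ] SchSp R}
    (hOp : IsSchrodingerOp R V t0 tR Hop) (hz : z ∈ resolventSetP Hop)
    (hOp' : IsSchrodingerOp R V t0' tR' Hop') (hz' : z ∈ resolventSetP Hop') (h : SchSp R) :
    ∃ p dp, SolODE R V z p dp ∧ res Hop z h - res Hop' z h = toSch R p := by
  obtain ⟨g, dg, ⟨h1, h2, k, h3, h4⟩, -⟩ := (hOp _ _).1 (res_mem_graph hz h)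
  obtain ⟨g', dg', ⟨h1', h2', k', h3', h4'⟩, -⟩ := (hOp' _ _).1 (res_mem_graph hz' h)
  have hgc : ContinuousOn g (Set.Icc 0 R) := fun x hx => (h2 x hx).continuousWithinAt
  have hgc' : ContinuousOn g' (Set.Icc 0 R) := fun x hx => (h2' x hx).continuousWithinAt
  have hk := integrable_of_rep hR.le h3
  have hk' := integrable_of_rep hR.le h3'
  have hi : ∀ {g k : ℝ → ℂ}, ContinuousOn g (Set.Icc 0 R) → IntervalIntegrable k volume 0 R →
      ∀ x ∈ Set.Icc 0 R, IntervalIntegrable (fun t => V t * g t - 0 * g t - k t) volume 0 x := by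
    intro g k hg hk x hx
    refine ((intervalIntegrable_mul_of_mem hV hg hx).sub
      (intervalIntegrable_mul_of_mem intervalIntegrable_const hg hx)).sub (hk.mono_set ?_)
    rw [Set.uIcc_of_le hx.1, Set.uIcc_of_le hR.le]
    exact Set.Icc_subset_Icc_right hx.2
  have hae : ∀ᵐ t, t ∈ Set.Ioc 0 R → k t - k' t = z * (g t - g' t) := by
    rw [← ae_restrict_iff' measurableSet_Ioc, ← restrict_Ioo_eq_restrict_Ioc]
    filter_upwards [h1, h1', h3, h3', Lp.coeFn_add h (z • res Hop z h),
      Lp.coeFn_add h (z • res Hop' z h), Lp.coeFn_smul z (res Hop z h),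
      Lp.coeFn_smul z (res Hop' z h)] with t a1 a2 a3 a4 a5 a6 a7 a8
    rw [← a3, ← a4, a5, a6, Pi.add_apply, Pi.add_apply, a7, a8, Pi.smul_apply, Pi.smul_apply, a1,
      a2, smul_eq_mul, smul_eq_mul]
    ring
  refine ⟨g - g', dg - dg', ⟨fun x hx => (h2 x hx).sub (h2' x hx), fun x hx => ?_⟩,
    eq_toSch (hgc.sub hgc') ?_⟩
  · rw [Pi.sub_apply, h4 x hx, h4' x hx, Pi.sub_apply, add_sub_add_comm,
      ← intervalIntegral.integral_sub (hi hgc hk x hx) (hi hgc' hk' x hx)]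
    congr 1
    refine intervalIntegral.integral_congr_ae ?_
    filter_upwards [hae] with t ht htx
    rw [Set.uIoc_of_le hx.1] at htx
    have := ht ⟨htx.1, htx.2.trans hx.2⟩
    rw [Pi.sub_apply]
    linear_combination -this
  · filter_upwards [h1, h1', Lp.coeFn_sub (res Hop z h) (res Hop' z h)] with t a1 a2 a3
    rw [a3, Pi.sub_apply, Pi.sub_apply, a1, a2]

end

theorem norm_mul_norm_le_of_bdry {t : ℝ} {a b e : ℂ}
    (h : Complex.cos t * a + Complex.sin t * b = e)
    (hs : Real.sin t ≠ 0 ∨ e = 0) :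
    ‖a‖ * ‖b‖ ≤ |Real.cos t / Real.sin t| * ‖a‖ ^ 2 + |1 / Real.sin t| * ‖e‖ * ‖a‖ := by
  rw [← Complex.ofReal_cos, ← Complex.ofReal_sin] at h
  by_cases hst : Real.sin t = 0
  · have h1 : e = 0 := hs.resolve_left (not_not.2 hst)
    have h2 : Real.cos t ≠ 0 := by
      intro h3
      have := Real.sin_sq_add_cos_sq t
      rw [hst, h3] at this
      norm_num at this
    rw [hst, h1, Complex.ofReal_zero, zero_mul, add_zero, mul_eq_zero] at h
    rw [h.resolve_left (Complex.ofReal_ne_zero.2 h2)]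
    simp
  · have hst' : (Real.sin t : ℂ) ≠ 0 := Complex.ofReal_ne_zero.2 hst
    have h1 : b = ((1 / Real.sin t : ℝ) : ℂ) * e - ((Real.cos t / Real.sin t : ℝ) : ℂ) * a := by
      push_cast at hst' h ⊢
      field_simp
      linear_combination h
    have h2 : ‖b‖ ≤ |1 / Real.sin t| * ‖e‖ + |Real.cos t / Real.sin t| * ‖a‖ := by
      rw [h1]
      refine (norm_sub_le _ _).trans_eq ?_
      rw [norm_mul, norm_mul, Complex.norm_real, Complex.norm_real, Real.norm_eq_abs,
        Real.norm_eq_abs]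
    nlinarith [mul_le_mul_of_nonneg_left h2 (norm_nonneg a)]

section
variable {R : ℝ} {V : ℝ → ℝ} {t0 tR : ℝ} {Hop : SchSp R →ₗ.[ℂ] SchSp R}

theorem norm_mul_norm_le_of_bdryC {u du : ℝ → ℂ} {e : Fin 2 → ℂ}
    (hb : bdryC R t0 tR u du = e)
    (hs : (Real.sin t0 ≠ 0 ∧ Real.sin tR ≠ 0) ∨ e = 0) :
    (‖u 0‖ * ‖du 0‖ ≤ (|Real.cos t0 / Real.sin t0| + |Real.cos tR / Real.sin tR|) * ‖u 0‖ ^ 2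
      + (|1 / Real.sin t0| * ‖e 0‖ + |1 / Real.sin tR| * ‖e 1‖) * ‖u 0‖) ∧
    ‖u R‖ * ‖du R‖ ≤ (|Real.cos t0 / Real.sin t0| + |Real.cos tR / Real.sin tR|) * ‖u R‖ ^ 2
      + (|1 / Real.sin t0| * ‖e 0‖ + |1 / Real.sin tR| * ‖e 1‖) * ‖u R‖ := by
  have hb0 : Complex.cos t0 * u 0 + Complex.sin t0 * du 0 = e 0 := congrFun hb 0
  have hb1 : Complex.cos tR * u R + Complex.sin tR * -du R = e 1 := by
    rw [mul_neg, ← sub_eq_add_neg]; exact congrFun hb 1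
  have h0 := norm_mul_norm_le_of_bdry hb0 (hs.imp (·.1) fun h => by rw [h]; rfl)
  have h1 := norm_mul_norm_le_of_bdry hb1 (hs.imp (·.2) fun h => by rw [h]; rfl)
  rw [norm_neg] at h1
  have p1 : 0 ≤ |Real.cos tR / Real.sin tR| * ‖u 0‖ ^ 2 := by positivity
  have p2 : 0 ≤ |Real.cos t0 / Real.sin t0| * ‖u R‖ ^ 2 := by positivity
  have p3 : 0 ≤ |1 / Real.sin tR| * ‖e 1‖ * ‖u 0‖ := by positivity
  have p4 : 0 ≤ |1 / Real.sin t0| * ‖e 0‖ * ‖u R‖ := by positivity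
  constructor <;> linarith

/-- A Schrödinger operator with real potential and boundary conditions is bounded below. -/
theorem IsSchrodingerOp.exists_semibound (hR : 0 < R) (hV : IntervalIntegrable V volume 0 R)
    (hOp : IsSchrodingerOp R (fun x => (V x : ℂ)) t0 tR Hop) :
    ∃ C : ℝ, ∀ u : Hop.domain, -C * ‖(u : SchSp R)‖ ^ 2 ≤ (⟪(u : SchSp R), Hop u⟫_ℂ).re := by
  refine ⟨((∫ x in (0 : ℝ)..R, |V x|)
    + 2 * (|Real.cos t0 / Real.sin t0| + |Real.cos tR / Real.sin tR|) + 1) * (1 / R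
      + 2 * ((∫ x in (0 : ℝ)..R, |V x|)
    + 2 * (|Real.cos t0 / Real.sin t0| + |Real.cos tR / Real.sin tR|) + 1)), fun u => ?_⟩
  obtain ⟨g, dg, ⟨h1, h2, k, h3, h4⟩, hb⟩ := (hOp _ _).1 (Hop.mem_graph u)
  have hbd := norm_mul_norm_le_of_bdryC hb (Or.inr rfl)
  have key := half_integral_normSq_deriv_le hR hV h2 (integrable_of_rep hR.le h3)
    (fun x hx => by simpa only [zero_mul, sub_zero] using h4 x hx) (by positivity) (by positivity)
    hbd.1 hbd.2 rfl
  rw [norm_sq_eq_integral hR.le h1, re_inner_eq_integral hR.le h1 h3]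
  have hA : 0 ≤ ∫ x in (0 : ℝ)..R, ‖dg x‖ ^ 2 :=
    intervalIntegral.integral_nonneg hR.le fun _ _ => by positivity
  simp only [Pi.zero_apply, norm_zero, mul_zero, add_zero, zero_pow two_ne_zero] at key
  linarith

/-- Solutions at purely imaginary spectral parameters with fixed boundary data are uniformly small
as soon as they are small in `L²`. -/
theorem tendsto_apply_of_tendsto_toSch (hR : 0 < R) (hV : IntervalIntegrable V volume 0 R)
    {τ : ℕ → ℝ} {s ds : ℕ → ℝ → ℂ}
    (hs : ∀ n, SolODE R (fun x => (V x : ℂ)) (Complex.I * τ n) (s n) (ds n))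
    {e : Fin 2 → ℂ} (hb : ∀ n, bdryC R t0 tR (s n) (ds n) = e)
    (h0 : Real.sin t0 ≠ 0) (h1 : Real.sin tR ≠ 0)
    (hlim : Tendsto (fun n => toSch R (s n)) atTop (nhds 0)) {x : ℝ} (hx : x ∈ Set.Icc 0 R) :
    Tendsto (fun n => s n x) atTop (nhds 0) := by
  have hVC : IntervalIntegrable (fun t => (V t : ℂ)) volume 0 R := ⟨hV.1.ofReal, hV.2.ofReal⟩
  set d := |1 / Real.sin t0| * ‖e 0‖ + |1 / Real.sin tR| * ‖e 1‖ with hd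
  set k := (∫ x in (0 : ℝ)..R, |V x|)
    + 2 * (|Real.cos t0 / Real.sin t0| + |Real.cos tR / Real.sin tR|) + 1 with hk
  set B : ℕ → ℝ := fun n => ∫ x in (0 : ℝ)..R, ‖s n x‖ ^ 2 with hB
  have hBlim : Tendsto B atTop (nhds 0) := by
    have h := (hlim.norm).pow 2
    rw [norm_zero, zero_pow two_ne_zero] at h
    refine h.congr fun n => norm_sq_eq_integral hR.le (coeFn_toSch (hs n).continuousOn)
  have hA : ∀ n, (∫ x in (0 : ℝ)..R, ‖ds n x‖ ^ 2) / 2 ≤ k * (1 / R + 2 * k) * B n + d ^ 2 := by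
    intro n
    have hbd := norm_mul_norm_le_of_bdryC (hb n) (Or.inl ⟨h0, h1⟩)
    have key := half_integral_normSq_deriv_le hR hV (hs n).1
      (h := fun t => Complex.I * τ n * s n t)
      (intervalIntegrable_mul_of_mem intervalIntegrable_const (hs n).continuousOn
        (Set.right_mem_Icc.2 hR.le))
      (fun x hx => by simpa only [sub_mul] using (hs n).2 x hx) (by positivity) (by positivity)
      hbd.1 hbd.2 rfl
    have hz : ∀ x, (starRingEnd ℂ (s n x) * (Complex.I * τ n * s n x)).re = 0 := by
      intro x
      simp only [Complex.mul_re, Complex.mul_im, Complex.conj_re, Complex.conj_im, Complex.I_re,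
        Complex.I_im, Complex.ofReal_re, Complex.ofReal_im]
      ring
    simp only [hz, intervalIntegral.integral_zero, add_zero] at key
    exact key
  have hsq : ∀ n, ∀ ε > 0, ‖s n x‖ ^ 2
      ≤ B n / R + B n / ε + ε * (2 * (k * (1 / R + 2 * k) * B n + d ^ 2)) := by
    intro n ε hε
    have hduc := continuousOn_of_primitive hR.le
      ((hs n).intervalIntegrable hVC (Set.right_mem_Icc.2 hR.le)) (hs n).2
    refine (normSq_le_of_deriv hR (hs n).1 hduc hε hx).trans ?_
    have := hA n
    gcongr
    linarith
  have hsqlim : Tendsto (fun n => ‖s n x‖ ^ 2) atTop (nhds 0) := by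
    refine Metric.tendsto_atTop.2 fun η hη => ?_
    set ε := η / (2 * d ^ 2 + 1) with hε
    have hε0 : 0 < ε := by positivity
    have hεη : ε * (2 * (k * (1 / R + 2 * k) * 0 + d ^ 2)) < η := by
      rw [mul_zero, zero_add, hε, div_mul_eq_mul_div, div_lt_iff₀ (by positivity)]
      nlinarith
    have hl : Tendsto (fun n => B n / R + B n / ε
        + ε * (2 * (k * (1 / R + 2 * k) * B n + d ^ 2))) atTop
        (nhds (0 / R + 0 / ε + ε * (2 * (k * (1 / R + 2 * k) * 0 + d ^ 2)))) :=
      ((hBlim.div_const R).add (hBlim.div_const ε)).add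
        ((((hBlim.const_mul _).add_const _).const_mul 2).const_mul ε)
    rw [zero_div, zero_div, zero_add, zero_add] at hl
    obtain ⟨n0, hn0⟩ := eventually_atTop.1 (hl.eventually (gt_mem_nhds hεη))
    refine ⟨n0, fun n hn => ?_⟩
    rw [Real.dist_eq, sub_zero, abs_of_nonneg (by positivity)]
    exact (hsq n ε hε0).trans_lt (hn0 n hn)
  rw [tendsto_zero_iff_norm_tendsto_zero]
  have := hsqlim.sqrt
  rw [Real.sqrt_zero] at this
  exact this.congr fun n => Real.sqrt_sq (norm_nonneg _)

theorem tendsto_bdryC_of_tendsto_toSch (hR : 0 < R) (hV : IntervalIntegrable V volume 0 R)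
    {t0' tR' : ℝ} {τ : ℕ → ℝ} {s ds : ℕ → ℝ → ℂ}
    (hs : ∀ n, SolODE R (fun x => (V x : ℂ)) (Complex.I * τ n) (s n) (ds n))
    {e : Fin 2 → ℂ} (hb : ∀ n, bdryC R t0' tR' (s n) (ds n) = e)
    (h0 : Real.sin t0' ≠ 0) (h1 : Real.sin tR' ≠ 0)
    (hlim : Tendsto (fun n => toSch R (s n)) atTop (nhds 0)) :
    Tendsto (fun n => bdryC R t0 tR (s n) (ds n)) atTop
      (nhds fun i => ![(Real.sin t0 / Real.sin t0' : ℂ), Real.sin tR / Real.sin tR'] i * e i) := by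
  have l0 := tendsto_apply_of_tendsto_toSch hR hV hs hb h0 h1 hlim (Set.left_mem_Icc.2 hR.le)
  have l1 := tendsto_apply_of_tendsto_toSch hR hV hs hb h0 h1 hlim (Set.right_mem_Icc.2 hR.le)
  have hb0 : ∀ n, Complex.cos t0' * s n 0 + Complex.sin t0' * ds n 0 = e 0 :=
    fun n => congrFun (hb n) 0
  have hb1 : ∀ n, Complex.cos tR' * s n R - Complex.sin tR' * ds n R = e 1 :=
    fun n => congrFun (hb n) 1
  have h0' : Complex.sin t0' ≠ 0 := by
    rw [← Complex.ofReal_sin]; exact Complex.ofReal_ne_zero.2 h0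
  have h1' : Complex.sin tR' ≠ 0 := by
    rw [← Complex.ofReal_sin]; exact Complex.ofReal_ne_zero.2 h1
  rw [tendsto_pi_nhds]
  intro i
  fin_cases i
  · have h := (l0.const_mul (Complex.cos t0 - Complex.sin t0 / Complex.sin t0'
      * Complex.cos t0')).add_const (Complex.sin t0 / Complex.sin t0' * e 0)
    rw [mul_zero, zero_add] at h
    simp only [Complex.ofReal_sin]
    refine h.congr fun n => ?_
    rw [← hb0 n]
    change _ = Complex.cos t0 * s n 0 + Complex.sin t0 * ds n 0
    field_simp
    ring
  · have h := (l1.const_mul (Complex.cos tR - Complex.sin tR / Complex.sin tR'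
      * Complex.cos tR')).add_const (Complex.sin tR / Complex.sin tR' * e 1)
    rw [mul_zero, zero_add] at h
    simp only [Complex.ofReal_sin]
    refine h.congr fun n => ?_
    rw [← hb1 n]
    change _ = Complex.cos tR * s n R - Complex.sin tR * ds n R
    field_simp
    ring

end

section
variable {R : ℝ} {V : ℝ → ℂ} {t0 tR : ℂ} {Hop : SchSp R →ₗ.[ℂ] SchSp R} {z : ℂ}
  {x dx : Fin 2 → ℝ → ℂ}

/-- Every solution is a combination of the solutions with unit boundary values. -/
theorem IsSchrodingerOp.toSch_eq_sum (hV : IntervalIntegrable V volume 0 R)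
    (hOp : IsSchrodingerOp R V t0 tR Hop) (hz : z ∈ resolventSetP Hop)
    (hx : ∀ l, SolODE R V z (x l) (dx l)) (hb : ∀ l, bdryC R t0 tR (x l) (dx l) = Pi.single l 1)
    {p dp : ℝ → ℂ} (hp : SolODE R V z p dp) :
    toSch R p = ∑ l, bdryC R t0 tR p dp l • toSch R (x l) := by
  set c := bdryC R t0 tR p dp with hc
  have hsol := ((hx 0).smul (c 0)).add hV ((hx 1).smul (c 1))
  rw [hOp.toSch_congr hV hz hp hsol, toSch_add ((hx 0).smul (c 0)).continuousOn
    ((hx 1).smul (c 1)).continuousOn, toSch_smul (hx 0).continuousOn,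
    toSch_smul (hx 1).continuousOn, Fin.sum_univ_two]
  rw [bdryC_add, bdryC_smul, bdryC_smul, hb, hb, ← hc]
  ext i; fin_cases i <;> simp

theorem linearIndependent_toSch (hR : 0 < R) (hV : IntervalIntegrable V volume 0 R)
    (hx : ∀ l, SolODE R V z (x l) (dx l)) (hb : ∀ l, bdryC R t0 tR (x l) (dx l) = Pi.single l 1) :
    LinearIndependent ℂ fun l => toSch R (x l) := by
  rw [Fintype.linearIndependent_iff]
  intro c hc
  have hsol := ((hx 0).smul (c 0)).add hV ((hx 1).smul (c 1))
  rw [Fin.sum_univ_two, ← toSch_smul (hx 0).continuousOn, ← toSch_smul (hx 1).continuousOn,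
    ← toSch_add ((hx 0).smul (c 0)).continuousOn ((hx 1).smul (c 1)).continuousOn] at hc
  have h := hsol.eq_zero_of_toSch hR hV hc
  have h0 := h 0 (Set.left_mem_Icc.2 hR.le)
  have h1 := h R (Set.right_mem_Icc.2 hR.le)
  have e : bdryC R t0 tR (c 0 • x 0 + c 1 • x 1) (c 0 • dx 0 + c 1 • dx 1) = 0 := by
    ext i; fin_cases i <;> simp [bdryC, -Pi.add_apply, -Pi.smul_apply, h0.1, h0.2, h1.1, h1.2]
  rw [bdryC_add, bdryC_smul, bdryC_smul, hb, hb] at e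
  intro i
  have := congrFun e i
  fin_cases i <;> simpa using this

end

theorem bddBelow_real_specP {A : H →ₗ.[ℂ] H} (hA : IsSelfAdjoint A)
    (hC : ∃ C : ℝ, ∀ u : A.domain, -C * ‖(u : H)‖ ^ 2 ≤ (⟪(u : H), A u⟫_ℂ).re) :
    BddBelow {x : ℝ | (x : ℂ) ∈ specP A} := by
  obtain ⟨C, hC⟩ := hC
  exact ⟨-C, fun x hx => not_lt.1 fun h => hx (mem_resolventSetP_of_semibounded hA hC h)⟩

theorem mem_resolventSetP_of_mem_offCut {A : H →ₗ.[ℂ] H} (hA : IsSelfAdjoint A) {S : Set ℝ}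
    (hS : BddBelow S) (hAS : {x : ℝ | (x : ℂ) ∈ specP A} ⊆ S) {z : ℂ} (hz : z ∈ offCut (sInf S)) :
    z ∈ resolventSetP A := by
  by_contra hcon
  have him : z.im = 0 := by
    by_contra h
    exact hcon (mem_resolventSetP_of_im_ne_zero hA h)
  have hzre : (z.re : ℂ) = z := Complex.ext rfl (by simp [him])
  have h1 : z.re ∈ S := hAS (by change (z.re : ℂ) ∈ specP A; rw [hzre]; exact hcon)
  rcases hz with h | h
  · exact h him
  · exact absurd (csInf_le hS h1) (not_le.2 h)

theorem offCut_subset {a c : ℝ} (h : a ≤ c) : offCut a ⊆ offCut c :=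
  fun _ hz => hz.imp_right fun h' => h'.trans_le h

theorem sin_ne_zero_of_mem {t : ℝ} (ht : t ∈ Set.Ioo 0 (2 * Real.pi) ∧ t ≠ Real.pi) :
    Real.sin t ≠ 0 := by
  rcases lt_or_gt_of_ne ht.2 with h | h
  · exact (Real.sin_pos_of_pos_of_lt_pi ht.1.1 h).ne'
  · have h1 := Real.sin_pos_of_pos_of_lt_pi (sub_pos.2 h) (by linarith [ht.1.2])
    rw [Real.sin_sub_pi] at h1
    linarith

/-- `R(w)` is recovered from `N² = R(z)` through the resolvent identity. -/
theorem sqrt_mul_mul_sqrt_eq {A : H →ₗ.[ℂ] H} {w z : ℂ} (hw : w ∈ resolventSetP A)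
    (hz : z ∈ resolventSetP A) {N : H →L[ℂ] H} (hN : N * N = res A z) :
    N * ((1 + (w - z) • res A w) * N) = res A w := by
  have hc : Commute N (res A w) := commute_res_of_commute_res hw hz (by
    rw [← hN]; exact (Commute.refl N).mul_right (Commute.refl N))
  rw [add_mul, one_mul, mul_add, hN, smul_mul_assoc, mul_smul_comm, ← hc.eq, ← mul_assoc, hN,
    ← res_sub_res hw hz, add_sub_cancel]

/-- Theorem 8.1: the symmetrized Fredholm perturbation determinant
reduces to the `2×2` determinant of the boundary data map:
`det(closure((H' - z)^{1/2}(H - z)⁻¹(H' - z)^{1/2})) =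
  (sin θ₀ sin θ_R / (sin θ₀' sin θ_R')) · det Λ_{θ₀,θ_R}^{θ₀',θ_R'}(z)`. -/
theorem statement12
    (Rr : ℝ) (hR : 0 < Rr) (V : ℝ → ℝ)
    (hV : MeasureTheory.IntegrableOn V (Set.Ioo 0 Rr) MeasureTheory.volume)
    (t0 tR t0' tR' : ℝ)
    (ht0 : t0 ∈ Set.Ico 0 (2 * Real.pi)) (htR : tR ∈ Set.Ico 0 (2 * Real.pi))
    (ht0' : t0' ∈ Set.Ioo 0 (2 * Real.pi) ∧ t0' ≠ Real.pi)
    (htR' : tR' ∈ Set.Ioo 0 (2 * Real.pi) ∧ tR' ≠ Real.pi)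
    (Hop Hop' : SchSp Rr →ₗ.[ℂ] SchSp Rr)
    (hHop : IsSchrodingerOp Rr (fun x => (V x : ℂ)) (t0 : ℂ) (tR : ℂ) Hop)
    (hHop' : IsSchrodingerOp Rr (fun x => (V x : ℂ)) (t0' : ℂ) (tR' : ℂ) Hop')
    (hsa : IsSelfAdjoint Hop) (hsa' : IsSelfAdjoint Hop')
    (b : HilbertBasis ℕ ℂ (SchSp Rr))
    (NH' : ℂ → (SchSp Rr →L[ℂ] SchSp Rr))
    (hNH' : IsSqrtResFam Rr Hop' (einf1 Rr Hop') NH')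
    (D : ℂ → (SchSp Rr →L[ℂ] SchSp Rr))
    (hD : ∀ z ∈ offCut (einf Rr Hop Hop'),
      (NH' z).comp ((D z).comp (NH' z)) = res Hop z)
    (Λ : ℂ → Matrix (Fin 2) (Fin 2) ℂ)
    (hΛ : ∀ z ∈ offCut (einf Rr Hop Hop'),
      IsBoundaryDataMap Rr (fun x => (V x : ℂ)) (t0 : ℂ) (tR : ℂ) (t0' : ℂ) (tR' : ℂ) z (Λ z)) :
    ∀ z ∈ offCut (einf Rr Hop Hop'),
      detI b (D z - 1) =
        ((Real.sin t0 * Real.sin tR / (Real.sin t0' * Real.sin tR') : ℝ) : ℂ) * (Λ z).det := by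
  intro z hz
  have hVi : IntervalIntegrable V volume 0 Rr := (intervalIntegrable_iff_Ioo hR.le).2 hV
  have hVC : IntervalIntegrable (fun t => (V t : ℂ)) volume 0 Rr := ⟨hVi.1.ofReal, hVi.2.ofReal⟩
  have hs0 := sin_ne_zero_of_mem ht0'
  have hsR := sin_ne_zero_of_mem htR'
  have hbdd : BddBelow {x : ℝ | (x : ℂ) ∈ specP Hop ∪ specP Hop'} :=
    (bddBelow_real_specP hsa (hHop.exists_semibound hR hVi)).union
      (bddBelow_real_specP hsa' (hHop'.exists_semibound hR hVi))
  have hzρ : z ∈ resolventSetP Hop :=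
    mem_resolventSetP_of_mem_offCut hsa hbdd (fun x hx => Or.inl hx) hz
  have hzρ' : z ∈ resolventSetP Hop' :=
    mem_resolventSetP_of_mem_offCut hsa' hbdd (fun x hx => Or.inr hx) hz
  have hnt : Nontrivial (SchSp Rr) := ⟨b 0, 0, fun h => by
    have := b.orthonormal.1 0
    rw [h, norm_zero] at this
    exact zero_ne_one this⟩
  have hle : einf Rr Hop Hop' ≤ einf1 Rr Hop' :=
    csInf_le_csInf hbdd (exists_real_mem_specP hsa') fun x hx => Or.inr hx
  set N := NH' z with hNdef
  have hN : N * N = res Hop' z := hNH'.1 z (offCut_subset hle hz)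
  have hNapp : ∀ x, N (N x) = res Hop' z x := fun x => congrArg (fun T => T x) hN
  have hDapp : ∀ x, N (D z (N x)) = res Hop z x := fun x => congrArg (fun T => T x) (hD z hz)
  have hinj : Function.Injective N := by
    refine (injective_iff_map_eq_zero _).2 fun x hx => res_injective hzρ' ?_
    rw [← hNapp, hx, map_zero, map_zero]
  have hdense : Dense (Set.range N) := by
    refine hsa'.dense_domain.mono ((domain_subset_range_res hzρ').trans ?_)
    rintro _ ⟨x, rfl⟩
    exact ⟨N x, hNapp x⟩
  choose x dx hx hxb using fun l : Fin 2 => hHop'.exists_solODE hR hVC hzρ' (Pi.single l 1)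
  set χ : Fin 2 → SchSp Rr := fun l => toSch Rr (x l) with hχ
  have hT : ∀ y, N ((D z - 1) y) = N (D z y) - N y := fun y => by
    rw [sub_apply, map_sub, one_apply_eq_self]
  set τ : ℕ → ℝ := fun n => n + 1 + ‖z‖ with hτ
  have hτ0 : ∀ n, 0 < τ n := fun n => by positivity
  have hτlim : Tendsto τ atTop atTop :=
    tendsto_atTop_add_const_right _ _ (tendsto_atTop_add_const_right _ _
      tendsto_natCast_atTop_atTop)
  set w : ℕ → ℂ := fun n => Complex.I * τ n with hw
  have hwim : ∀ n, (w n).im ≠ 0 := fun n => by simpa [hw] using (hτ0 n).ne'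
  have hwnorm : ∀ n, ‖w n‖ = τ n := fun n => by
    rw [hw, norm_mul, Complex.norm_I, one_mul, Complex.norm_real, Real.norm_of_nonneg (hτ0 n).le]
  have hw0 : ∀ n, w n ≠ 0 := fun n h => hwim n (by rw [h]; rfl)
  have hwz : ∀ n, w n ≠ z := fun n h => by
    have h1 := hwnorm n
    rw [h] at h1
    have h2 : (0 : ℝ) ≤ n := n.cast_nonneg
    simp only [hτ] at h1
    linarith
  have hwinv : Tendsto (fun n => (w n)⁻¹) atTop (nhds 0) := by
    rw [tendsto_zero_iff_norm_tendsto_zero]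
    simp only [norm_inv, hwnorm]
    exact tendsto_inv_atTop_zero.comp hτlim
  have hwρ' : ∀ n, w n ∈ resolventSetP Hop' := fun n => mem_resolventSetP_of_im_ne_zero hsa' (hwim n)
  have hreslim := tendsto_neg_smul_res hsa' hτ0 hτlim
  choose s ds hs hsb using fun (n : ℕ) (l : Fin 2) =>
    hHop'.exists_solODE hR hVC (hwρ' n) (Pi.single l 1)
  have hs_eq : ∀ n l, χ l + (w n - z) • res Hop' (w n) (χ l) = toSch Rr (s n l) := by
    intro n l
    rw [hχ, hHop'.res_toSch hVC (hwρ' n) (hwz n).symm (hx l) (hs n l) ((hxb l).trans (hsb n l).symm),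
      smul_smul, ← neg_sub z (w n), neg_mul, mul_inv_cancel₀ (sub_ne_zero.2 (hwz n).symm),
      neg_one_smul]
    abel
  have hslim : ∀ l, Tendsto (fun n => toSch Rr (s n l)) atTop (nhds 0) := by
    intro l
    have h := (tendsto_const_nhds (x := χ l)).sub (hreslim (χ l)) |>.add
      ((hwinv.const_mul z).smul (hreslim (χ l)))
    rw [sub_self, mul_zero, zero_smul, add_zero] at h
    refine h.congr fun n => ?_
    rw [← hs_eq n l]
    change χ l - -(w n) • res Hop' (w n) (χ l)
      + (z * (w n)⁻¹) • -(w n) • res Hop' (w n) (χ l) = _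
    have := hw0 n
    match_scalars <;> field_simp
    ring
  set M : ℕ → Fin 2 → Fin 2 → ℂ := fun n l => bdryC Rr t0 tR (s n l) (ds n l) with hM
  set K : ℕ → Matrix (Fin 2) (Fin 2) ℂ := fun n => Matrix.of fun k l =>
    (1 - z * (w n)⁻¹)⁻¹ * ((Λ z).mulVec (M n l) k - (Pi.single l 1 : Fin 2 → ℂ) k) with hK
  set δ : Fin 2 → ℂ := ![(Real.sin t0 / Real.sin t0' : ℂ), Real.sin tR / Real.sin tR'] with hδ
  have hMlim : ∀ l, Tendsto (fun n => M n l) atTop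
      (nhds fun i => δ i * (Pi.single l 1 : Fin 2 → ℂ) i) := fun l =>
    tendsto_bdryC_of_tendsto_toSch hR hVi (fun n => hs n l) (fun n => hsb n l) hs0 hsR (hslim l)
  have hKlim : Tendsto K atTop (nhds (Λ z * Matrix.diagonal δ - 1)) := by
    refine tendsto_pi_nhds.2 fun k => tendsto_pi_nhds.2 fun l => ?_
    have h1 : Tendsto (fun n => (1 - z * (w n)⁻¹)⁻¹) atTop (nhds 1) := by
      have := (tendsto_const_nhds (x := (1 : ℂ))).sub (hwinv.const_mul z)
      rw [mul_zero, sub_zero] at this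
      simpa using this.inv₀ one_ne_zero
    have h2 : Tendsto (fun n => (Λ z).mulVec (M n l) k) atTop
        (nhds ((Λ z).mulVec (fun i => δ i * (Pi.single l 1 : Fin 2 → ℂ) i) k)) := by
      simp only [Matrix.mulVec, dotProduct]
      exact tendsto_finsetSum _ fun i _ => (tendsto_pi_nhds.1 (hMlim l) i).const_mul _
    have h3 := h1.mul (h2.sub_const ((Pi.single l 1 : Fin 2 → ℂ) k))
    have e : (Λ z * Matrix.diagonal δ - 1) k l = 1 * ((Λ z).mulVec
        (fun i => δ i * (Pi.single l 1 : Fin 2 → ℂ) i) k - (Pi.single l 1 : Fin 2 → ℂ) k) := by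
      rw [Matrix.sub_apply, Matrix.mul_diagonal, one_mul, Matrix.one_apply, Pi.single_apply]
      congr 1
      simp [Matrix.mulVec, dotProduct, Pi.single_apply]
    change Tendsto (fun n => K n k l) atTop (nhds ((Λ z * Matrix.diagonal δ - 1) k l))
    rw [e]
    exact h3
  have hdet := detI_eq_det_of_tendsto b N (D z - 1) hinj hdense χ
    (linearIndependent_toSch hR hVC hx hxb) (fun y => by
      obtain ⟨p, dp, hp, hpe⟩ := hHop.exists_res_sub_res hR hVC hzρ hHop' hzρ' y
      rw [hT, hDapp, hNapp, hpe, hHop'.toSch_eq_sum hVC hzρ' hx hxb hp]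
      exact Submodule.sum_mem _ fun l _ =>
        Submodule.smul_mem _ _ (Submodule.subset_span ⟨l, rfl⟩))
    (fun n => -(w n) • (1 + (w n - z) • res Hop' (w n))) (fun y => by
      refine (hreslim y).congr fun n => ?_
      rw [smul_apply, map_smul]
      congr 1
      exact congrArg (fun T => T y) (sqrt_mul_mul_sqrt_eq (hwρ' n) hzρ' hN).symm)
    K _ (fun n l => by
      obtain ⟨p, dp, hp, hpb⟩ := hHop.exists_solODE hR hVC hzρ (M n l)
      have hY : (-(w n) • (1 + (w n - z) • res Hop' (w n))) (χ l) = -(w n) • toSch Rr (s n l) := by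
        rw [← hs_eq, smul_apply, add_apply, smul_apply, one_apply_eq_self]
      have hp' := hΛ z hz p dp hp
      rw [hpb] at hp'
      have hpe := hHop'.toSch_eq_sum hVC hzρ' hx hxb hp
      rw [← hp'] at hpe
      have hχe := hHop'.toSch_eq_sum hVC hzρ' hx hxb (hx l)
      rw [hxb l] at hχe
      rw [hT, hDapp, hNapp, hY, map_smul, map_smul,
        hHop.res_toSch hVC hzρ (hwz n) (hs n l) hp hpb.symm,
        hHop'.res_toSch hVC hzρ' (hwz n) (hs n l) (hx l) ((hsb n l).trans (hxb l).symm)]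
      simp only [hK, Matrix.of_apply, mul_smul, sub_smul, smul_sub, Finset.sum_sub_distrib,
        ← Finset.smul_sum]
      rw [← hχe, ← hpe]
      have h1 := hw0 n
      have h2 := sub_ne_zero.2 (hwz n)
      have h3 : (1 - z * (w n)⁻¹)⁻¹ = w n * (w n - z)⁻¹ := by
        field_simp
      rw [h3]
      module) hKlim
  rw [hdet, add_sub_cancel, Matrix.det_mul, Matrix.det_diagonal, Fin.prod_univ_two, hδ]
  simp only [Matrix.cons_val_zero, Matrix.cons_val_one]
  push_cast
  ring

end
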